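/- arXiv:math/0703908 — 4 statements merged into one kernel-verified Lean document; each statement's English description precedes it below -/
import Mathlib

section
/- For 0 < β²/2 < 2π, the derivative with respect to β of F(β) = ∑_{n=1}^∞ (1/n)·(1/√(2π))·∫_{β√n}^∞ e^{-x²/2} dx satisfies F'(β) + 1/β = −(1/√(2π))·∑_{r=0}^∞ ζ(1/2 − r)·(−β²/2)^r / r!, where ζ is the Riemann zeta function (analytically continued). -/
open Real MeasureTheory Set

open Filter Topology in
lemma aux_freq {f g : ℂ → ℂ} {c d x0 : ℝ} (hx : x0 ∈ Ioo c d)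
    (h : ∀ x : ℝ, x ∈ Ioo c d → f x = g x) : ∃ᶠ z in 𝓝[≠] (x0 : ℂ), f z = g z := by
  have ht : Tendsto (fun x : ℝ => (x : ℂ)) (𝓝[≠] x0) (𝓝[≠] (x0 : ℂ)) := by
    refine tendsto_nhdsWithin_of_tendsto_nhds_of_eventually_within _ ?_ ?_
    · exact (Complex.continuous_ofReal.tendsto x0).mono_left nhdsWithin_le_nhds
    · filter_upwards [self_mem_nhdsWithin] with x hx
      simpa using hx
  have : ∀ᶠ x : ℝ in 𝓝[≠] x0, f x = g x := by
    filter_upwards [nhdsWithin_le_nhds (Ioo_mem_nhds hx.1 hx.2)] with x hx using h x hx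
  exact ht.frequently this.frequently

lemma aux_int {w b : ℝ} (hw : 0 < w) (hb : 0 < b) :
    IntegrableOn (fun t : ℝ => t ^ (w - 1) * Real.exp (-b * t)) (Ioi 0) := by
  have := integrableOn_rpow_mul_exp_neg_mul_rpow (p := 1) (s := w - 1) (b := b) (by linarith) one_pos hb
  simpa using this

lemma aux_laplace {w : ℝ} (hw : 0 < w) {r : ℂ} (hr : 0 < r.re) :
    ∫ t in Ioi (0:ℝ), (t:ℂ) ^ ((w:ℂ) - 1) * Complex.exp (-(r * t)) = (1 / r) ^ (w:ℂ) * Complex.Gamma w := by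
  set U : Set ℂ := {z | 0 < z.re} with hU
  have hUo : IsOpen U := isOpen_lt continuous_const Complex.continuous_re
  have hUc : IsPreconnected U := (convex_halfSpace_re_gt 0).isPreconnected
  have hmeas : ∀ z : ℂ, ∀ v : ℝ, AEStronglyMeasurable
      (fun t : ℝ => (t:ℂ) ^ ((v:ℂ) - 1) * Complex.exp (-(z * t))) (volume.restrict (Ioi 0)) := by
    intro z v
    refine ContinuousOn.aestronglyMeasurable ?_ measurableSet_Ioi
    refine ContinuousOn.mul ?_ (by fun_prop)
    intro t ht
    refine ContinuousAt.continuousWithinAt ?_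
    exact ContinuousAt.comp (f := fun t : ℝ => (t:ℂ)) (g := fun t : ℂ => t ^ ((v:ℂ) - 1))
      (continuousAt_cpow_const (by left; simpa using ht)) (by fun_prop)
  have hnorm : ∀ z : ℂ, ∀ v t : ℝ, 0 < t →
      ‖(t:ℂ) ^ ((v:ℂ) - 1) * Complex.exp (-(z * t))‖ = t ^ (v - 1) * Real.exp (-z.re * t) := by
    intro z v t ht
    rw [norm_mul, Complex.norm_exp, Complex.norm_cpow_eq_rpow_re_of_pos ht]
    simp
  have hintg : ∀ z : ℂ, 0 < z.re → ∀ v : ℝ, 0 < v → IntegrableOn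
      (fun t : ℝ => (t:ℂ) ^ ((v:ℂ) - 1) * Complex.exp (-(z * t))) (Ioi 0) := by
    intro z hz v hv
    refine (aux_int hv hz).mono' (hmeas z v) ?_
    refine (ae_restrict_iff' measurableSet_Ioi).2 (Filter.Eventually.of_forall fun t ht => ?_)
    exact (hnorm z v t ht).le
  have hf : DifferentiableOn ℂ
      (fun z : ℂ => ∫ t in Ioi (0:ℝ), (t:ℂ) ^ ((w:ℂ) - 1) * Complex.exp (-(z * t))) U := by
    intro z hz
    have hz' : 0 < z.re := hz
    have key := hasDerivAt_integral_of_dominated_loc_of_deriv_le (𝕜 := ℂ)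
      (μ := volume.restrict (Ioi (0:ℝ))) (x₀ := z) (s := Metric.ball z (z.re/2))
      (F := fun (z : ℂ) (t : ℝ) => (t:ℂ) ^ ((w:ℂ) - 1) * Complex.exp (-(z * t)))
      (F' := fun (z : ℂ) (t : ℝ) => -((t:ℂ) ^ (((w+1 : ℝ):ℂ) - 1) * Complex.exp (-(z * t))))
      (bound := fun t => t ^ ((w + 1) - 1) * Real.exp (-(z.re/2) * t))
      (Metric.ball_mem_nhds z (by linarith)) (Filter.Eventually.of_forall fun z => hmeas z w)
      (hintg z hz' w hw) ((hmeas z (w+1)).neg) ?_ (aux_int (by linarith) (by linarith)) ?_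
    · exact key.2.differentiableAt.differentiableWithinAt
    · refine (ae_restrict_iff' measurableSet_Ioi).2 (Filter.Eventually.of_forall fun t ht => ?_)
      intro x hx
      have ht' : (0:ℝ) < t := ht
      rw [norm_neg, hnorm x (w+1) t ht]
      gcongr
      have h1 := Complex.abs_re_le_norm (x - z)
      rw [Metric.mem_ball, dist_eq_norm] at hx
      have h2 := (abs_lt.1 (lt_of_le_of_lt h1 hx)).1
      simp at h2
      linarith
    · refine (ae_restrict_iff' measurableSet_Ioi).2 (Filter.Eventually.of_forall fun t ht => ?_)
      intro x hx
      have ht' : (0:ℝ) < t := ht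
      have h0 : (t:ℂ) ≠ 0 := by exact_mod_cast ht'.ne'
      have h1 : HasDerivAt (fun x : ℂ => Complex.exp (-(x * t))) (Complex.exp (-(x*t)) * (-(1 * t))) x :=
        (((hasDerivAt_id x).mul_const (t:ℂ)).neg).cexp
      have h2 := h1.const_mul ((t:ℂ) ^ ((w:ℂ) - 1))
      refine h2.congr_deriv ?_
      have : (((w+1 : ℝ):ℂ) - 1) = ((w:ℂ) - 1) + 1 := by push_cast; ring
      rw [this, Complex.cpow_add _ _ h0, Complex.cpow_one]
      ring
  have hg : DifferentiableOn ℂ (fun z : ℂ => (1 / z) ^ (w:ℂ) * Complex.Gamma w) U := by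
    intro z hz
    have hz' : 0 < z.re := hz
    have hz0 : z ≠ 0 := by rintro rfl; simp at hz'
    refine DifferentiableAt.differentiableWithinAt ?_
    refine DifferentiableAt.mul_const ?_ _
    refine DifferentiableAt.cpow_const (by fun_prop (disch := assumption)) ?_
    left
    rw [one_div, Complex.inv_re]
    exact div_pos hz' (Complex.normSq_pos.2 hz0)
  have := (hf.analyticOnNhd hUo).eqOn_of_preconnected_of_frequently_eq (hg.analyticOnNhd hUo) hUc
    (z₀ := ((1:ℝ):ℂ)) (by simp [hU]) (aux_freq (c := 0) (d := 2) (by norm_num) ?_)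
  · exact this hr
  · intro x hx
    exact Complex.integral_cpow_mul_exp_neg_mul_Ioi (by simpa using hw) hx.1

open Complex in
lemma aux_binom {w : ℝ} (hw : 0 < w) {x : ℂ} (hx : ‖x‖ < 1) :
    HasSum (fun r : ℕ => Complex.Gamma (w + r) / r.factorial * x ^ r) (Complex.Gamma w / (1 - x) ^ (w:ℂ)) := by
  have h := (Complex.one_div_one_sub_cpow_hasFPowerSeriesOnBall_zero (w:ℂ)).hasSum (y := x)
    (by simpa [Metric.mem_eball, edist_zero_right, enorm_eq_nnnorm, ← NNReal.coe_lt_coe] using hx)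
  have h2 := h.mul_left (Complex.Gamma w)
  have hG : Complex.Gamma w ≠ 0 := Complex.Gamma_ne_zero_of_re_pos (by simpa using hw)
  simp only [zero_add, mul_one_div] at h2
  convert! h2 using 1
  ext r
  have h3 := Ring.factorial_nsmul_multichoose_eq_ascPochhammer (w:ℂ) r
  rw [Ring.multichoose_eq, Polynomial.ascPochhammer_smeval_eq_eval, ← Complex.Gamma_add_nat_div_Gamma_eq (w:ℂ)] at h3
  · have hr : (r.factorial : ℂ) ≠ 0 := by exact_mod_cast r.factorial_ne_zero
    simp only [nsmul_eq_mul] at h3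
    rw [eq_div_iff hG] at h3
    rw [FormalMultilinearSeries.ofScalars_apply_eq, smul_eq_mul, ← h3]
    field_simp
  · intro k hk
    have := congrArg Complex.re hk
    simp at this
    have : (0:ℝ) ≤ k := k.cast_nonneg
    linarith


lemma aux_sum_int {w a : ℝ} (hw : 1 < w) (ha : 0 < a) :
    Summable (fun m : ℤ => (1 / ((a:ℂ) + 2 * π * Complex.I * m)) ^ (w:ℂ)) := by
  refine Summable.of_norm_bounded_eventually (Real.summable_abs_int_rpow hw) ?_
  rw [Filter.eventually_cofinite]
  refine (Set.finite_singleton (0:ℤ)).subset ?_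
  intro m hm
  by_contra hm0
  apply hm
  have hm0' : (m:ℝ) ≠ 0 := by exact_mod_cast hm0
  rw [Complex.norm_cpow_real, norm_div, norm_one, one_div, Real.inv_rpow (norm_nonneg _),
    Real.rpow_neg (abs_nonneg _)]
  have hpos : 0 < |(m:ℝ)| := abs_pos.2 hm0'
  have h1 : |(m:ℝ)| ≤ ‖(a:ℂ) + 2 * π * Complex.I * m‖ := by
    have := Complex.abs_im_le_norm ((a:ℂ) + 2 * π * Complex.I * m)
    simp at this
    refine le_trans ?_ this
    have : 1 ≤ |2 * π| := by
      rw [abs_of_pos (by positivity)]; linarith [Real.pi_gt_three]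
    simp only [abs_mul, Nat.abs_ofNat] at this ⊢
    nlinarith
  gcongr

open Filter Asymptotics FourierTransform in
lemma aux_lip {w a : ℝ} (hw : 1 < w) (ha : 0 < a) :
    ∑' n : ℕ, ((n + 1 : ℝ) : ℂ) ^ ((w:ℂ) - 1) * Complex.exp (-(a * (n + 1 : ℝ)))
      = ∑' m : ℤ, (1 / ((a:ℂ) + 2 * π * Complex.I * m)) ^ (w:ℂ) * Complex.Gamma w := by
  set f : ℝ → ℂ := fun x => ((max x 0 : ℝ) : ℂ) ^ ((w:ℂ) - 1) * Complex.exp (-(a * x)) with hf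
  have hw1 : ((w:ℂ) - 1) ≠ 0 := by
    have : w - 1 ≠ 0 := by linarith
    exact_mod_cast this
  have hneg : ∀ x : ℝ, x ≤ 0 → f x = 0 := by
    intro x hx
    simp [hf, max_eq_right hx, Complex.zero_cpow hw1]
  have hpos : ∀ x : ℝ, 0 < x → f x = (x : ℂ) ^ ((w:ℂ) - 1) * Complex.exp (-(a * x)) := by
    intro x hx
    simp [hf, max_eq_left hx.le]
  have hc : Continuous f := by
    refine Continuous.mul ?_ (by fun_prop)
    exact (Complex.continuous_ofReal_cpow_const (y := (w:ℂ) - 1) (by simpa using hw)).comp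
      (continuous_id.max continuous_const)
  have hO : f =O[cocompact ℝ] fun x : ℝ => |x| ^ (-(2:ℝ)) := by
    rw [cocompact_eq_atBot_atTop, isBigO_sup]
    constructor
    · refine (isBigO_zero _ _).congr' ?_ EventuallyEq.rfl
      filter_upwards [eventually_le_atBot (0:ℝ)] with x hx
      rw [hneg x hx]
    · have h1 := ((isLittleO_exp_neg_mul_rpow_atTop ha (-2 - (w - 1))).isBigO).norm_left
      have h2 := (isBigO_refl (fun x : ℝ => x ^ (w - 1)) atTop).mul h1
      refine IsBigO.of_norm_left (h2.congr' ?_ ?_)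
      · filter_upwards [eventually_gt_atTop (0:ℝ)] with x hx
        rw [hpos x hx, norm_mul, Complex.norm_exp, Complex.norm_cpow_eq_rpow_re_of_pos hx]
        simp
      · filter_upwards [eventually_gt_atTop (0:ℝ)] with x hx
        rw [← Real.rpow_add hx, abs_of_pos hx]
        congr 1; ring
  have hF : ∀ m : ℤ, 𝓕 f m = (1 / ((a:ℂ) + 2 * π * Complex.I * m)) ^ (w:ℂ) * Complex.Gamma w := by
    intro m
    rw [← aux_laplace (by linarith) (by simpa using ha), Real.fourier_real_eq_integral_exp_smul]
    have : (fun v : ℝ => Complex.exp (↑(-2 * π * v * m) * Complex.I) • f v) =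
        (Ioi (0:ℝ)).indicator (fun t : ℝ => (t:ℂ) ^ ((w:ℂ) - 1) *
          Complex.exp (-(((a:ℂ) + 2 * π * Complex.I * m) * t))) := by
      ext v
      by_cases hv : 0 < v
      · rw [indicator_of_mem (by exact hv), hpos v hv, smul_eq_mul, mul_left_comm, ← Complex.exp_add]
        congr 2
        push_cast
        ring
      · rw [indicator_of_notMem (by simpa using hv), hneg v (not_lt.1 hv), smul_zero]
    rw [this, integral_indicator measurableSet_Ioi]
  have hS : Summable fun m : ℤ => 𝓕 f m := by
    simp_rw [hF]
    exact (aux_sum_int hw ha).mul_right _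
  have P := Real.tsum_eq_tsum_fourier_of_rpow_decay_of_summable hc one_lt_two hO hS 0
  simp only [zero_add, hF, QuotientAddGroup.mk_zero, fourier_eval_zero, mul_one] at P
  rw [← P]
  have hinj : Function.Injective (fun n : ℕ => ((n:ℤ) + 1)) := by
    intro x y h; simpa using h
  rw [← hinj.tsum_eq (f := fun m : ℤ => f m)]
  · refine tsum_congr fun n => ?_
    rw [hpos _ (by push_cast; positivity)]
    push_cast
    rfl
  · intro m hm
    have : 0 < (m:ℝ) := by
      by_contra h
      exact hm (hneg _ (not_lt.1 h))
    have : 0 < m := by exact_mod_cast this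
    exact ⟨(m - 1).toNat, by simp; omega⟩

/-- expansion at one lattice point -/
lemma aux_expand {w a : ℝ} (hw : 0 < w) {z : ℂ} (ha : 0 < a) (hz : z.re = 0) (hza : a < ‖z‖) :
    HasSum (fun r : ℕ => Complex.Gamma (w + r) * (-(a:ℂ)) ^ r / r.factorial * (1 / z ^ ((w:ℂ) + r)))
      ((1 / ((a:ℂ) + z)) ^ (w:ℂ) * Complex.Gamma w) := by
  have hz0 : z ≠ 0 := by rintro rfl; simp at hza; linarith
  have hx : ‖-(a:ℂ) / z‖ < 1 := by
    rw [norm_div, norm_neg, Complex.norm_real, Real.norm_of_nonneg ha.le,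
      div_lt_one (norm_pos_iff.2 hz0)]
    exact hza
  have h := (aux_binom hw hx).mul_left (1 / z ^ (w:ℂ))
  have hre : (1 - -(a:ℂ) / z).re = 1 := by
    simp [Complex.div_re, hz]
  have h10 : (1 - -(a:ℂ) / z) ≠ 0 := by
    intro h; rw [h] at hre; simp at hre
  have hmul : (a:ℂ) + z = z * (1 - -(a:ℂ) / z) := by field_simp; ring
  have hlog : Complex.log ((a:ℂ) + z) = Complex.log z + Complex.log (1 - -(a:ℂ) / z) := by
    rw [hmul, Complex.log_mul hz0 h10]
    have h1 : |z.arg| ≤ π / 2 := Complex.abs_arg_le_pi_div_two_iff.2 hz.ge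
    have h2 : |(1 - -(a:ℂ) / z).arg| < π / 2 :=
      Complex.abs_arg_lt_pi_div_two_iff.2 (Or.inl (by rw [hre]; exact one_pos))
    rw [abs_le] at h1
    rw [abs_lt] at h2
    constructor <;> linarith [h1.1, h1.2, h2.1, h2.2]
  have haz : (a:ℂ) + z ≠ 0 := by rw [hmul]; exact mul_ne_zero hz0 h10
  have harg : ((a:ℂ) + z).arg ≠ π := by
    have : |((a:ℂ) + z).arg| < π / 2 :=
      Complex.abs_arg_lt_pi_div_two_iff.2 (Or.inl (by simpa [hz] using ha))
    have := (abs_lt.1 this).2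
    linarith [Real.pi_pos]
  convert! h using 1
  · ext r
    rw [Complex.cpow_add _ _ hz0, Complex.cpow_natCast, div_pow]
    field_simp
  · rw [one_div, Complex.inv_cpow _ _ harg, Complex.cpow_def_of_ne_zero haz, hlog, add_mul, Complex.exp_add,
      ← Complex.cpow_def_of_ne_zero hz0, ← Complex.cpow_def_of_ne_zero h10]
    field_simp

lemma aux_cos {s : ℂ} {m : ℝ} (hm : 0 < m) :
    1 / (2 * π * Complex.I * m) ^ s + 1 / (2 * π * Complex.I * (-m)) ^ s =
      2 * (2 * π : ℂ) ^ (-s) * Complex.cos (π * s / 2) * (1 / (m:ℂ) ^ s) := by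
  have hp : 0 < 2 * π * m := by positivity
  have e1 : (2 * π * Complex.I * m : ℂ) = ((2 * π * m : ℝ) : ℂ) * Complex.I := by push_cast; ring
  have e2 : (2 * π * Complex.I * (-m) : ℂ) = ((2 * π * m : ℝ) : ℂ) * (-Complex.I) := by push_cast; ring
  have hI : (-Complex.I) ≠ 0 := neg_ne_zero.2 Complex.I_ne_zero
  have hpc : ((2 * π * m : ℝ) : ℂ) ≠ 0 := by exact_mod_cast hp.ne'
  have h2p : (2 * π : ℂ) = ((2 * π : ℝ) : ℂ) := by push_cast; rfl
  have h2pc : (2 * π : ℂ) ≠ 0 := by rw [h2p]; exact_mod_cast Real.two_pi_pos.ne'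
  have hmc : (m:ℂ) ≠ 0 := by exact_mod_cast hm.ne'
  have hl : ((Real.log (2 * π * m) : ℝ) : ℂ) = Complex.log (2 * π) + Complex.log m := by
    rw [Real.log_mul (by positivity) hm.ne', h2p, ← Complex.ofReal_log (by positivity),
      ← Complex.ofReal_log hm.le]
    push_cast; rfl
  simp only [one_div, ← Complex.cpow_neg]
  rw [e1, e2, Complex.cpow_def_of_ne_zero (mul_ne_zero hpc Complex.I_ne_zero),
    Complex.cpow_def_of_ne_zero (mul_ne_zero hpc hI), Complex.log_ofReal_mul hp Complex.I_ne_zero,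
    Complex.log_ofReal_mul hp hI, Complex.log_I, Complex.log_neg_I, hl, Complex.cos,
    Complex.cpow_def_of_ne_zero h2pc, Complex.cpow_def_of_ne_zero hmc]
  have : ∀ A B C D : ℂ, 2 * Complex.exp A * ((Complex.exp B + Complex.exp C) / 2) * Complex.exp D
      = Complex.exp (A + D + C) + Complex.exp (A + D + B) := by
    intro A B C D
    simp only [Complex.exp_add]; ring
  rw [this]
  congr 2 <;> ring


lemma aux_norm1 (G x f A B C : ℂ) (r : ℕ) : ‖G * x ^ r / f * (2 * A * B * C)‖ =
    ‖G‖ * ‖x‖ ^ r / ‖f‖ * (2 * ‖A‖ * ‖B‖ * ‖C‖) := by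
  simp only [norm_mul, norm_div, norm_pow, Complex.norm_ofNat]

lemma aux_norm2 (G x f : ℂ) (r : ℕ) : ‖G / f * x ^ r‖ = ‖G‖ / ‖f‖ * ‖x‖ ^ r := by
  simp only [norm_mul, norm_div, norm_pow]

lemma aux_core_real {w a : ℝ} (hw : 1 < w) (ha : 0 < a) (ha2 : a < 2 * π) :
    ∑' n : ℕ, ((n + 1 : ℝ) : ℂ) ^ ((w:ℂ) - 1) * Complex.exp (-(a * (n + 1 : ℝ)))
      = (1 / (a:ℂ)) ^ (w:ℂ) * Complex.Gamma w +
        ∑' r : ℕ, riemannZeta (1 - w - r) * (-(a:ℂ)) ^ r / r.factorial := by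
  rw [aux_lip hw ha]
  set g : ℤ → ℂ := fun m => (1 / ((a:ℂ) + 2 * π * Complex.I * m)) ^ (w:ℂ) * Complex.Gamma w with hg
  have hgs : Summable g := (aux_sum_int hw ha).mul_right _
  have hn : Summable fun n : ℕ => g n := hgs.comp_injective Nat.cast_injective
  have hp : Summable fun n : ℕ => g ((n + 1 : ℕ) : ℤ) := (summable_nat_add_iff 1).2 hn
  have hm : Summable fun n : ℕ => g (-((n:ℤ) + 1)) :=
    hgs.comp_injective (i := fun n : ℕ => (-((n:ℤ) + 1))) (fun x y h => by simpa using h)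
  rw [tsum_of_nat_of_neg_add_one hn hm, hn.tsum_eq_zero_add, add_assoc, ← hp.tsum_add hm]
  have h0 : g ((0:ℕ):ℤ) = (1 / (a:ℂ)) ^ (w:ℂ) * Complex.Gamma w := by simp [hg]
  rw [h0]
  congr 1
  set T : ℕ → ℕ → ℂ := fun m r => Complex.Gamma (w + r) * (-(a:ℂ)) ^ r / r.factorial *
    (2 * (2 * π : ℂ) ^ (-((w:ℂ) + r)) * Complex.cos (π * ((w:ℂ) + r) / 2) *
      (1 / (((m:ℝ) + 1 : ℝ):ℂ) ^ ((w:ℂ) + r))) with hT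
  have hTm : ∀ m : ℕ, HasSum (T m) (g ((m + 1 : ℕ) : ℤ) + g (-((m:ℤ) + 1))) := by
    intro m
    have hm1 : (0:ℝ) < (m:ℝ) + 1 := by positivity
    have hnorm : a < 2 * π * ((m:ℝ) + 1) := by
      have : (0:ℝ) ≤ m := m.cast_nonneg
      nlinarith [Real.pi_pos]
    have e1 := aux_expand (w := w) (z := 2 * π * Complex.I * (((m:ℝ) + 1 : ℝ):ℂ)) (by linarith) ha
      (by simp) (by
        rw [norm_mul, norm_mul, norm_mul, Complex.norm_I, Complex.norm_real, Complex.norm_real,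
          Real.norm_of_nonneg hm1.le, Real.norm_of_nonneg Real.pi_pos.le]
        simpa using hnorm)
    have e2 := aux_expand (w := w) (z := 2 * π * Complex.I * (-(((m:ℝ) + 1 : ℝ):ℂ))) (by linarith) ha
      (by simp) (by
        rw [norm_mul, norm_mul, norm_mul, Complex.norm_I, norm_neg, Complex.norm_real, Complex.norm_real,
          Real.norm_of_nonneg hm1.le, Real.norm_of_nonneg Real.pi_pos.le]
        simpa using hnorm)
    convert! e1.add e2 using 1
    · ext r
      rw [← mul_add, aux_cos hm1]
    · simp [hg]
  have hTs : Summable (Function.uncurry T) := by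
    have hx : ‖((a / (2 * π) : ℝ) : ℂ)‖ < 1 := by
      rw [Complex.norm_real, Real.norm_of_nonneg (by positivity), div_lt_one (by positivity)]
      exact ha2
    have s1 := (aux_binom (w := w) (by linarith) hx).summable.norm
    have s2 : Summable fun m : ℕ => 2 * (1 / ((m:ℝ) + 1) ^ w) := by
      refine Summable.mul_left _ ?_
      have := (Real.summable_one_div_nat_add_rpow 1 w).2 hw
      refine this.congr fun m => ?_
      rw [abs_of_pos (by positivity)]
    refine Summable.of_norm_bounded (s2.mul_of_nonneg s1 (fun m => by positivity) (fun r => norm_nonneg _)) ?_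
    rintro ⟨m, r⟩
    simp only [Function.uncurry, hT]
    have hm1 : (1:ℝ) ≤ (m:ℝ) + 1 := by
      have : (0:ℝ) ≤ m := m.cast_nonneg
      linarith
    have n1 : ‖(2 * π : ℂ) ^ (-((w:ℂ) + r))‖ ≤ 1 / (2 * π) ^ r := by
      rw [show (2 * π : ℂ) = ((2 * π : ℝ) : ℂ) by push_cast; rfl,
        Complex.norm_cpow_eq_rpow_re_of_pos (by positivity)]
      have : (-((w:ℂ) + r)).re = -(w + r) := by simp [add_comm]
      rw [this, Real.rpow_neg (by positivity), one_div, ← Real.rpow_natCast]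
      gcongr
      · linarith [Real.pi_gt_three]
      · linarith
    have n2 : ‖Complex.cos (π * ((w:ℂ) + r) / 2)‖ ≤ 1 := by
      rw [show (π * ((w:ℂ) + r) / 2) = ((π * (w + r) / 2 : ℝ) : ℂ) by push_cast; rfl,
        ← Complex.ofReal_cos, Complex.norm_real]
      exact Real.abs_cos_le_one _
    have n3 : ‖(1 / (((m:ℝ) + 1 : ℝ):ℂ) ^ ((w:ℂ) + r))‖ ≤ 1 / ((m:ℝ) + 1) ^ w := by
      rw [norm_div, norm_one, Complex.norm_cpow_eq_rpow_re_of_pos (by positivity)]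
      have : ((w:ℂ) + r).re = w + r := by simp
      rw [this]
      gcongr 1
      exact Real.rpow_le_rpow_of_exponent_le hm1 (by simp)
    have n4 : ‖((a / (2 * π) : ℝ) : ℂ)‖ = a / (2 * π) := by
      rw [Complex.norm_real, Real.norm_of_nonneg (by positivity)]
    have n5 : ‖(-(a:ℂ))‖ = a := by
      rw [norm_neg, Complex.norm_real, Real.norm_of_nonneg ha.le]
    rw [aux_norm1, aux_norm2, n4, n5, div_pow]
    calc _ ≤ ‖Complex.Gamma (w + r)‖ * a ^ r / ‖(r.factorial:ℂ)‖ * (2 * (1 / (2 * π) ^ r) * 1 * (1 / ((m:ℝ) + 1) ^ w)) := by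
            gcongr
      _ = _ := by field_simp
  have hTr : ∀ r : ℕ, ∑' m : ℕ, T m r = riemannZeta (1 - w - r) * (-(a:ℂ)) ^ r / r.factorial := by
    intro r
    have hr0 : (0:ℝ) ≤ r := r.cast_nonneg
    have hre : ((w:ℂ) + r).re = w + r := by simp
    simp only [hT]
    rw [tsum_mul_left, tsum_mul_left]
    have hz := zeta_eq_tsum_one_div_nat_add_one_cpow (s := (w:ℂ) + r) (by rw [hre]; linarith)
    have h1 := riemannZeta_one_sub (s := (w:ℂ) + r)
      (by
        intro n h
        have := congrArg Complex.re h
        rw [hre] at this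
        have h0 : (0:ℝ) ≤ n := n.cast_nonneg
        simp at this
        linarith)
      (by
        intro h
        have := congrArg Complex.re h
        rw [hre] at this
        simp at this
        linarith)
    rw [show (1 - (w:ℂ) - r) = 1 - (w + r) by ring, h1, hz]
    push_cast
    ring
  calc _ = ∑' m, ∑' r, T m r := tsum_congr fun m => (hTm m).tsum_eq.symm
    _ = ∑' r, ∑' m, T m r := hTs.tsum_comm.symm
    _ = _ := tsum_congr hTr


lemma aux_normGamma {z : ℂ} (hz : 0 < z.re) : ‖Complex.Gamma z‖ ≤ Real.Gamma z.re := by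
  rw [Complex.Gamma_eq_integral hz, Real.Gamma_eq_integral hz, Complex.GammaIntegral]
  refine (norm_integral_le_integral_norm _).trans (le_of_eq ?_)
  refine setIntegral_congr_fun measurableSet_Ioi fun t ht => ?_
  rw [norm_mul, Complex.norm_cpow_eq_rpow_re_of_pos ht, Complex.norm_real,
    Real.norm_of_nonneg (Real.exp_pos _).le]
  simp

lemma aux_normcos (z : ℂ) : ‖Complex.cos z‖ ≤ Real.exp |z.im| := by
  rw [Complex.cos, norm_div, Complex.norm_ofNat, div_le_iff₀ two_pos]
  refine (norm_add_le _ _).trans ?_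
  rw [Complex.norm_exp, Complex.norm_exp]
  have h1 : (z * Complex.I).re ≤ |z.im| := by simp [neg_le_abs]
  have h2 : (-z * Complex.I).re ≤ |z.im| := by simp [le_abs_self]
  have := Real.exp_le_exp.2 h1
  have := Real.exp_le_exp.2 h2
  linarith

lemma aux_normzeta {s : ℂ} (hs : 2 ≤ s.re) :
    ‖riemannZeta s‖ ≤ ∑' n : ℕ, 1 / ((n:ℝ) + 1) ^ (2:ℝ) := by
  rw [zeta_eq_tsum_one_div_nat_add_one_cpow (by linarith)]
  have s2 : Summable fun m : ℕ => (1 / ((m:ℝ) + 1) ^ (2:ℝ)) := by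
    have := (Real.summable_one_div_nat_add_rpow 1 2).2 one_lt_two
    refine this.congr fun m => ?_
    rw [abs_of_pos (by positivity)]
  refine tsum_of_norm_bounded s2.hasSum fun n => ?_
  rw [norm_div, norm_one, show ((n:ℂ) + 1) = (((n:ℝ) + 1 : ℝ) : ℂ) by push_cast; rfl,
    Complex.norm_cpow_eq_rpow_re_of_pos (by positivity)]
  gcongr 1
  exact Real.rpow_le_rpow_of_exponent_le (by simp) hs

lemma aux_term {a : ℝ} (ha : 0 < a) {s : ℂ} (h1 : -1 < s.re) (h2 : s.re < 1) (h3 : |s.im| < 1)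
    {r : ℕ} (hr : 2 ≤ r) :
    ‖riemannZeta (s - r) * (-(a:ℂ)) ^ r / r.factorial‖ ≤
      (2 * Real.exp (π / 2) * ∑' n : ℕ, 1 / ((n:ℝ) + 1) ^ (2:ℝ)) *
       ‖Complex.Gamma (((2:ℝ):ℂ) + r) / r.factorial * ((a / (2 * π) : ℝ) : ℂ) ^ r‖ := by
  have hr2 : (2:ℝ) ≤ r := by exact_mod_cast hr
  set z : ℂ := 1 - s + r with hz
  have hre : z.re = 1 - s.re + r := by simp [hz]
  have him : z.im = - s.im := by simp [hz]
  have hfe := riemannZeta_one_sub (s := z)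
    (by
      intro n h
      have := congrArg Complex.re h
      rw [hre] at this
      have h0 : (0:ℝ) ≤ n := n.cast_nonneg
      simp at this
      linarith)
    (by
      intro h
      have := congrArg Complex.re h
      rw [hre] at this
      simp at this
      linarith)
  have n1 : ‖(2 * π : ℂ) ^ (-z)‖ ≤ 1 / (2 * π) ^ r := by
    rw [show (2 * π : ℂ) = ((2 * π : ℝ) : ℂ) by push_cast; rfl,
      Complex.norm_cpow_eq_rpow_re_of_pos (by positivity)]
    rw [Complex.neg_re, Real.rpow_neg (by positivity), one_div, ← Real.rpow_natCast]
    gcongr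
    · linarith [Real.pi_gt_three]
    · linarith
  have n2 : ‖Complex.cos (π * z / 2)‖ ≤ Real.exp (π / 2) := by
    refine (aux_normcos _).trans (Real.exp_le_exp.2 ?_)
    have : (π * z / 2 : ℂ).im = π / 2 * (- s.im) := by
      rw [← him, show (π * z / 2 : ℂ) = ((π / 2 : ℝ) : ℂ) * z by push_cast; ring, Complex.im_ofReal_mul]
    rw [this, abs_mul, abs_neg, abs_of_pos (by positivity)]
    nlinarith [Real.pi_pos]
  have n3 : ‖Complex.Gamma z‖ ≤ ‖Complex.Gamma (((2:ℝ):ℂ) + r)‖ := by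
    have e : Complex.Gamma (((2:ℝ):ℂ) + r) = ((Real.Gamma (2 + r) : ℝ) : ℂ) := by
      rw [← Complex.Gamma_ofReal]; push_cast; rfl
    rw [e, Complex.norm_real, Real.norm_of_nonneg (Real.Gamma_nonneg_of_nonneg (by linarith))]
    refine (aux_normGamma (by rw [hre]; linarith)).trans ?_
    exact Real.Gamma_strictMonoOn_Ici.monotoneOn (by rw [mem_Ici, hre]; linarith)
      (by rw [mem_Ici]; linarith) (by rw [hre]; linarith)
  have n4 := aux_normzeta (s := z) (by rw [hre]; linarith)
  have n5 : ‖((a / (2 * π) : ℝ) : ℂ)‖ = a / (2 * π) := by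
    rw [Complex.norm_real, Real.norm_of_nonneg (by positivity)]
  have n6 : ‖(-(a:ℂ))‖ = a := by
    rw [norm_neg, Complex.norm_real, Real.norm_of_nonneg ha.le]
  set Z := ∑' n : ℕ, 1 / ((n:ℝ) + 1) ^ (2:ℝ) with hZ
  rw [show s - r = 1 - z by rw [hz]; ring, hfe, norm_div, norm_mul, norm_mul, norm_mul, norm_mul,
    norm_mul, norm_pow, n6, aux_norm2, n5, div_pow, Complex.norm_ofNat]
  calc _ ≤ 2 * (1 / (2 * π) ^ r) * ‖Complex.Gamma (((2:ℝ):ℂ) + r)‖ * Real.exp (π / 2) * Z * a ^ r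
        / ‖(r.factorial : ℂ)‖ := by gcongr
    _ = _ := by field_simp

lemma aux_term_summable {a : ℝ} (ha : 0 < a) (ha2 : a < 2 * π) :
    Summable fun r : ℕ => (2 * Real.exp (π / 2) * ∑' n : ℕ, 1 / ((n:ℝ) + 1) ^ (2:ℝ)) *
      ‖Complex.Gamma (((2:ℝ):ℂ) + (r + 2 : ℕ)) / (r + 2).factorial *
        ((a / (2 * π) : ℝ) : ℂ) ^ (r + 2)‖ := by
  have hx : ‖((a / (2 * π) : ℝ) : ℂ)‖ < 1 := by
    rw [Complex.norm_real, Real.norm_of_nonneg (by positivity), div_lt_one (by positivity)]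
    exact ha2
  have s1 := (aux_binom (w := 2) (by linarith) hx).summable.norm
  exact ((summable_nat_add_iff 2).2 s1).mul_left _

lemma aux_sum_zeta {a : ℝ} (ha : 0 < a) (ha2 : a < 2 * π) {s : ℂ} (h1 : -1 < s.re) (h2 : s.re < 1)
    (h3 : |s.im| < 1) : Summable fun r : ℕ => riemannZeta (s - r) * (-(a:ℂ)) ^ r / r.factorial := by
  rw [← summable_nat_add_iff 2]
  exact Summable.of_norm_bounded (aux_term_summable ha ha2) fun r => aux_term ha h1 h2 h3 (by omega)

lemma aux_cont {a : ℝ} (ha : 0 < a) (ha2 : a < 2 * π) :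
    ∑' n : ℕ, ((n + 1 : ℝ) : ℂ) ^ (-((1 / 2 : ℝ) : ℂ)) * Complex.exp (-(a * (n + 1 : ℝ)))
      = (1 / (a:ℂ)) ^ (1 - ((1 / 2 : ℝ) : ℂ)) * Complex.Gamma (1 - ((1 / 2 : ℝ) : ℂ)) +
        ∑' r : ℕ, riemannZeta (((1 / 2 : ℝ) : ℂ) - r) * (-(a:ℂ)) ^ r / r.factorial := by
  set U : Set ℂ := {s | -1 < s.re ∧ s.re < 1 ∧ |s.im| < 1} with hU
  have hUo : IsOpen U := by
    refine (isOpen_lt continuous_const Complex.continuous_re).inter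
      ((isOpen_lt Complex.continuous_re continuous_const).inter
        (isOpen_lt Complex.continuous_im.abs continuous_const))
  have hUc : IsPreconnected U := by
    refine Convex.isPreconnected ?_
    intro x hx y hy p q hp hq hpq
    obtain ⟨x1, x2, x3⟩ := hx
    obtain ⟨y1, y2, y3⟩ := hy
    rw [abs_lt] at x3 y3
    have cv : ∀ u v : ℝ, u ∈ Ioo (-1:ℝ) 1 → v ∈ Ioo (-1:ℝ) 1 → p * u + q * v ∈ Ioo (-1:ℝ) 1 :=
      fun u v hu hv => (convex_Ioo (-1:ℝ) 1) hu hv hp hq hpq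
    have c1 := cv _ _ ⟨x1, x2⟩ ⟨y1, y2⟩
    have c2 := cv _ _ x3 y3
    refine ⟨?_, ?_, ?_⟩
    · simpa using c1.1
    · simpa using c1.2
    · rw [abs_lt]; simpa using c2
  have hexp : ∀ n : ℕ, ‖Complex.exp (-(a * (n + 1 : ℝ)))‖ = Real.exp (-a * (n + 1 : ℝ)) := by
    intro n
    rw [Complex.norm_exp]
    simp
  have hL : DifferentiableOn ℂ (fun s : ℂ => ∑' n : ℕ, ((n + 1 : ℝ) : ℂ) ^ (-s) *
      Complex.exp (-(a * (n + 1 : ℝ)))) U := by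
    have hs := (summable_nat_add_iff 1).2 (Real.summable_pow_mul_exp_neg_nat_mul 1 ha)
    refine Complex.differentiableOn_tsum_of_summable_norm hs ?_ hUo ?_
    · intro n
      have : ((n + 1 : ℝ) : ℂ) ≠ 0 := by
        have : (n + 1 : ℝ) ≠ 0 := by positivity
        exact_mod_cast this
      intro s _
      refine DifferentiableAt.differentiableWithinAt ?_
      refine DifferentiableAt.mul_const ?_ _
      exact DifferentiableAt.const_cpow (by fun_prop) (Or.inl this)
    · intro n s hs
      rw [norm_mul, hexp, Complex.norm_cpow_eq_rpow_re_of_pos (by positivity)]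
      push_cast
      gcongr
      rw [pow_one]
      calc ((n:ℝ) + 1) ^ (-s).re ≤ ((n:ℝ) + 1) ^ (1:ℝ) :=
            Real.rpow_le_rpow_of_exponent_le (by simp) (by simp; linarith [hs.1])
        _ = _ := Real.rpow_one _
  have hzd : ∀ r : ℕ, DifferentiableOn ℂ
      (fun s : ℂ => riemannZeta (s - r) * (-(a:ℂ)) ^ r / r.factorial) U := by
    intro r s hs
    refine DifferentiableAt.differentiableWithinAt ?_
    refine DifferentiableAt.div_const (DifferentiableAt.mul_const ?_ _) _
    refine DifferentiableAt.comp (f := fun s : ℂ => s - (r:ℂ)) (g := riemannZeta) s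
      (differentiableAt_riemannZeta ?_) (by fun_prop)
    intro h
    have := congrArg Complex.re h
    simp at this
    have h0 : (0:ℝ) ≤ r := r.cast_nonneg
    linarith [hs.2.1]
  have hR : DifferentiableOn ℂ (fun s : ℂ => (1 / (a:ℂ)) ^ (1 - s) * Complex.Gamma (1 - s) +
        ∑' r : ℕ, riemannZeta (s - r) * (-(a:ℂ)) ^ r / r.factorial) U := by
    refine DifferentiableOn.add ?_ ?_
    · intro s hs
      refine DifferentiableAt.differentiableWithinAt ?_
      have ha0 : (1 / (a:ℂ)) ≠ 0 := by
        have : (a:ℂ) ≠ 0 := by exact_mod_cast ha.ne'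
        exact one_div_ne_zero this
      refine DifferentiableAt.mul (DifferentiableAt.const_cpow (by fun_prop) (Or.inl ha0)) ?_
      refine DifferentiableAt.comp (f := fun s : ℂ => 1 - s) (g := Complex.Gamma) s
        (Complex.differentiableAt_Gamma _ ?_) (by fun_prop)
      intro m h
      have := congrArg Complex.re h
      simp at this
      have h0 : (0:ℝ) ≤ m := m.cast_nonneg
      linarith [hs.2.1]
    · have hd : DifferentiableOn ℂ (fun s : ℂ =>
          (∑ r ∈ Finset.range 2, riemannZeta (s - r) * (-(a:ℂ)) ^ r / r.factorial) +
          ∑' r : ℕ, riemannZeta (s - (r + 2 : ℕ)) * (-(a:ℂ)) ^ (r + 2) / (r + 2).factorial) U := by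
        refine DifferentiableOn.add (DifferentiableOn.fun_sum fun r _ => hzd r) ?_
        exact Complex.differentiableOn_tsum_of_summable_norm (aux_term_summable ha ha2)
          (fun r => hzd (r + 2)) hUo
          (fun r s hs => aux_term ha hs.1 hs.2.1 hs.2.2 (by omega))
      refine hd.congr fun s hs => ?_
      exact ((aux_sum_zeta ha ha2 hs.1 hs.2.1 hs.2.2).sum_add_tsum_nat_add 2).symm
  have := (hL.analyticOnNhd hUo).eqOn_of_preconnected_of_frequently_eq (hR.analyticOnNhd hUo) hUc
    (z₀ := ((-1/2:ℝ):ℂ)) ?_ (aux_freq (c := -1) (d := 0) (by norm_num) ?_)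
  · exact this (by rw [hU]; simp only [mem_setOf_eq, Complex.ofReal_re, Complex.ofReal_im]; norm_num)
  · rw [hU]; simp only [mem_setOf_eq, Complex.ofReal_re, Complex.ofReal_im]; norm_num
  · intro x hx
    have := aux_core_real (w := 1 - x) (by linarith [hx.2]) ha ha2
    simp only [Complex.ofReal_sub, Complex.ofReal_one, sub_sub_cancel, sub_sub_cancel_left] at this
    exact this


lemma aux_gint : Integrable (fun x : ℝ => Real.exp (-x ^ 2 / 2)) := by
  have := integrable_exp_neg_mul_sq (b := 1 / 2) (by norm_num)
  refine this.congr (Filter.Eventually.of_forall fun x => ?_)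
  simp only
  congr 1; ring

lemma aux_gint4 : Integrable (fun x : ℝ => Real.exp (-x ^ 2 / 4)) := by
  have := integrable_exp_neg_mul_sq (b := 1 / 4) (by norm_num)
  refine this.congr (Filter.Eventually.of_forall fun x => ?_)
  simp only
  congr 1; ring

lemma aux_tail_deriv (u : ℝ) :
    HasDerivAt (fun v => ∫ x in Ioi v, Real.exp (-x ^ 2 / 2)) (-Real.exp (-u ^ 2 / 2)) u := by
  have hc : Continuous (fun x : ℝ => Real.exp (-x ^ 2 / 2)) := by fun_prop
  have h : (fun v => ∫ x in Ioi v, Real.exp (-x ^ 2 / 2)) =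
      fun v => (∫ x in Ioi (0:ℝ), Real.exp (-x ^ 2 / 2)) - ∫ x in (0:ℝ)..v, Real.exp (-x ^ 2 / 2) := by
    funext v
    rw [← intervalIntegral.integral_interval_add_Ioi (a := 0) (b := v)
      aux_gint.integrableOn aux_gint.integrableOn]
    ring
  rw [h]
  have := intervalIntegral.integral_hasDerivAt_right (hc.intervalIntegrable 0 u)
    hc.stronglyMeasurable.stronglyMeasurableAtFilter hc.continuousAt
  simpa using this.const_sub (∫ x in Ioi (0:ℝ), Real.exp (-x ^ 2 / 2))

lemma aux_tail_bound {u : ℝ} (hu : 0 ≤ u) :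
    |∫ x in Ioi u, Real.exp (-x ^ 2 / 2)| ≤
      Real.exp (-u ^ 2 / 4) * ∫ x, Real.exp (-x ^ 2 / 4) := by
  rw [abs_of_nonneg (by positivity)]
  calc ∫ x in Ioi u, Real.exp (-x ^ 2 / 2)
      ≤ ∫ x in Ioi u, Real.exp (-u ^ 2 / 4) * Real.exp (-x ^ 2 / 4) := by
        refine setIntegral_mono_on aux_gint.integrableOn
          (aux_gint4.const_mul _).integrableOn measurableSet_Ioi fun x hx => ?_
        rw [← Real.exp_add]
        apply Real.exp_le_exp.mpr
        have : u < x := hx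
        nlinarith
    _ ≤ ∫ x, Real.exp (-u ^ 2 / 4) * Real.exp (-x ^ 2 / 4) :=
        setIntegral_le_integral (aux_gint4.const_mul _)
          (Filter.Eventually.of_forall fun x => by positivity)
    _ = _ := integral_const_mul _ _

lemma aux_expsum {c : ℝ} (hc : 0 < c) : Summable fun n : ℕ => Real.exp (-c * ((n : ℝ) + 1)) := by
  have := Real.summable_pow_mul_exp_neg_nat_mul 0 hc
  have := (summable_nat_add_iff 1).2 this
  simpa using this

lemma aux_deriv (β : ℝ) (hβ : 0 < β) :
    HasDerivAt (fun b : ℝ => ∑' n : ℕ,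
      (1 / ((n : ℝ) + 1)) * (1 / Real.sqrt (2 * π)) *
        ∫ x in Ioi (b * Real.sqrt ((n : ℝ) + 1)), Real.exp (-x ^ 2 / 2))
      (∑' n : ℕ, (1 / ((n : ℝ) + 1)) * (1 / Real.sqrt (2 * π)) *
        (-Real.exp (-(β * Real.sqrt ((n : ℝ) + 1)) ^ 2 / 2) * Real.sqrt ((n : ℝ) + 1))) β := by
  have hs : 1 ≤ Real.sqrt (2 * π) := by
    rw [Real.one_le_sqrt]; linarith [Real.pi_gt_three]
  have hs' : 1 / Real.sqrt (2 * π) ≤ 1 := by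
    rw [div_le_one (by linarith)]; exact hs
  have hs0 : 0 ≤ 1 / Real.sqrt (2 * π) := by positivity
  have hc : 0 < (β / 2) ^ 2 / 2 := by positivity
  refine hasDerivAt_tsum_of_isPreconnected (t := Ioi (β / 2)) (y₀ := β) (aux_expsum hc) isOpen_Ioi
    isPreconnected_Ioi (g := fun (n : ℕ) (b : ℝ) => (1 / ((n : ℝ) + 1)) * (1 / Real.sqrt (2 * π)) *
        ∫ x in Ioi (b * Real.sqrt ((n : ℝ) + 1)), Real.exp (-x ^ 2 / 2))
    (g' := fun (n : ℕ) (b : ℝ) => (1 / ((n : ℝ) + 1)) * (1 / Real.sqrt (2 * π)) *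
        (-Real.exp (-(b * Real.sqrt ((n : ℝ) + 1)) ^ 2 / 2) * Real.sqrt ((n : ℝ) + 1)))
    ?_ ?_ (mem_Ioi.2 (by linarith)) ?_ (mem_Ioi.2 (by linarith))
  · intro n b hb
    have h1 := (aux_tail_deriv (b * Real.sqrt ((n : ℝ) + 1))).comp b
      ((hasDerivAt_id b).mul_const (Real.sqrt ((n : ℝ) + 1)))
    have h2 := h1.const_mul ((1 / ((n : ℝ) + 1)) * (1 / Real.sqrt (2 * π)))
    simpa [Function.comp_def] using h2
  · intro n b hb
    have hb : β / 2 < b := hb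
    have hn : (0:ℝ) ≤ n := Nat.cast_nonneg n
    have hq : Real.sqrt ((n : ℝ) + 1) ≤ (n:ℝ) + 1 := by
      rw [Real.sqrt_le_left (by linarith)]; nlinarith
    have e1 : -(b * Real.sqrt ((n : ℝ) + 1)) ^ 2 / 2 ≤ -((β / 2) ^ 2 / 2) * ((n : ℝ) + 1) := by
      rw [mul_pow, Real.sq_sqrt (by linarith)]
      have : (β / 2) ^ 2 ≤ b ^ 2 := by gcongr
      nlinarith
    rw [Real.norm_eq_abs, abs_mul, abs_mul, abs_mul, abs_neg, abs_of_nonneg hs0,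
      abs_of_nonneg (Real.exp_pos _).le, abs_of_nonneg (Real.sqrt_nonneg _),
      abs_of_nonneg (by positivity : 0 ≤ 1 / ((n:ℝ) + 1))]
    calc _ ≤ 1 / ((n:ℝ) + 1) * 1 * (Real.exp (-((β / 2) ^ 2 / 2) * ((n : ℝ) + 1)) * ((n:ℝ) + 1)) := by
          gcongr
      _ = _ := by field_simp
  · have hc2 : 0 < β ^ 2 / 4 := by positivity
    refine Summable.of_norm_bounded
      ((aux_expsum hc2).mul_right (∫ x, Real.exp (-x ^ 2 / 4))) fun n => ?_
    have hn : (0:ℝ) ≤ n := Nat.cast_nonneg n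
    have h1 : 1 / ((n:ℝ) + 1) ≤ 1 := by
      rw [div_le_one (by linarith)]; linarith
    have h0 : 0 ≤ 1 / ((n:ℝ) + 1) := by positivity
    have hb := aux_tail_bound (u := β * Real.sqrt ((n : ℝ) + 1)) (by positivity)
    have e : -(β * Real.sqrt ((n : ℝ) + 1)) ^ 2 / 4 = -(β ^ 2 / 4) * ((n : ℝ) + 1) := by
      rw [mul_pow, Real.sq_sqrt (by linarith)]; ring
    rw [e] at hb
    rw [Real.norm_eq_abs, abs_mul, abs_mul, abs_of_nonneg hs0, abs_of_nonneg h0]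
    calc _ ≤ 1 * 1 * |∫ x in Ioi (β * Real.sqrt ((n : ℝ) + 1)), Real.exp (-x ^ 2 / 2)| := by
          gcongr
      _ ≤ _ := by simpa using hb

lemma aux_final {β : ℝ} (hβ : 0 < β) (hβ' : β ^ 2 / 2 < 2 * π) :
    ∑' n : ℕ, ((n : ℝ) + 1) ^ (-(1 / 2 : ℝ)) * Real.exp (-(β ^ 2 / 2 * ((n:ℝ) + 1))) =
      Real.sqrt (2 * π) / β +
        ∑' r : ℕ, (riemannZeta (1 / 2 - (r : ℂ))).re * (-β ^ 2 / 2) ^ r / r.factorial := by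
  have ha : 0 < β ^ 2 / 2 := by positivity
  have h := congrArg Complex.re (aux_cont ha hβ')
  have hsum := aux_sum_zeta (s := ((1 / 2 : ℝ) : ℂ)) ha hβ' (by rw [Complex.ofReal_re]; norm_num)
    (by rw [Complex.ofReal_re]; norm_num) (by rw [Complex.ofReal_im]; norm_num)
  rw [Complex.add_re, Complex.re_tsum hsum] at h
  have hL : ∀ n : ℕ, ((n + 1 : ℝ) : ℂ) ^ (-((1 / 2 : ℝ) : ℂ)) *
      Complex.exp (-(((β ^ 2 / 2 : ℝ) : ℂ) * (n + 1 : ℝ))) =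
      ((((n : ℝ) + 1) ^ (-(1 / 2 : ℝ)) * Real.exp (-(β ^ 2 / 2 * ((n:ℝ) + 1))) : ℝ) : ℂ) := by
    intro n
    rw [Complex.ofReal_mul, Complex.ofReal_cpow (by positivity), Complex.ofReal_exp]
    push_cast
    rfl
  have hG : ((1 / ((β ^ 2 / 2 : ℝ) : ℂ)) ^ (1 - ((1 / 2 : ℝ) : ℂ)) *
      Complex.Gamma (1 - ((1 / 2 : ℝ) : ℂ))) = ((Real.sqrt (2 * π) / β : ℝ) : ℂ) := by
    have e1 : (1 - ((1 / 2 : ℝ) : ℂ)) = ((1 / 2 : ℝ) : ℂ) := by push_cast; norm_num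
    have e2 : (1 / ((β ^ 2 / 2 : ℝ) : ℂ)) = ((1 / (β ^ 2 / 2) : ℝ) : ℂ) := by push_cast; rfl
    rw [e1, e2, ← Complex.ofReal_cpow (by positivity), Complex.Gamma_ofReal, ← Complex.ofReal_mul,
      Real.Gamma_one_half_eq, ← Real.sqrt_eq_rpow]
    congr 1
    have : 1 / (β ^ 2 / 2) = 2 / β ^ 2 := by field_simp
    rw [this, Real.sqrt_div (by norm_num), Real.sqrt_sq hβ.le, Real.sqrt_mul (by norm_num)]
    ring
  have hR : ∀ r : ℕ, (riemannZeta (((1 / 2 : ℝ) : ℂ) - r) * (-((β ^ 2 / 2 : ℝ) : ℂ)) ^ r /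
      r.factorial).re = (riemannZeta (1 / 2 - (r : ℂ))).re * (-β ^ 2 / 2) ^ r / r.factorial := by
    intro r
    have e1 : (-((β ^ 2 / 2 : ℝ) : ℂ)) ^ r = (((-β ^ 2 / 2) ^ r : ℝ) : ℂ) := by
      push_cast; ring
    have e2 : (((1 / 2 : ℝ) : ℂ) - r) = 1 / 2 - (r : ℂ) := by push_cast; rfl
    have e3 : ((r.factorial : ℕ) : ℂ) = ((r.factorial : ℝ) : ℂ) := by push_cast; rfl
    rw [e1, e2, e3, Complex.div_ofReal_re, Complex.re_mul_ofReal]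
  rw [hG, Complex.ofReal_re, tsum_congr hR, tsum_congr hL, ← Complex.ofReal_tsum,
    Complex.ofReal_re] at h
  exact h


/-- For `0 < β²/2 < 2π` (with `β > 0`), the derivative of
`F(β) = ∑_{n≥1} (1/n)·(1/√(2π))·∫_{β√n}^∞ e^{-x²/2} dx` satisfies
`F'(β) + 1/β = −(1/√(2π))·∑_{r≥0} ζ(1/2 − r)·(−β²/2)^r / r!`. -/
theorem deriv_F_eq_zeta_series (β : ℝ) (hβ : 0 < β) (hβ' : β ^ 2 / 2 < 2 * π)
    (F : ℝ → ℝ)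
    (hF : ∀ b : ℝ, F b = ∑' n : ℕ,
      (1 / ((n : ℝ) + 1)) * (1 / Real.sqrt (2 * π)) *
        ∫ x in Ioi (b * Real.sqrt ((n : ℝ) + 1)), Real.exp (-x ^ 2 / 2)) :
    deriv F β + 1 / β =
      -(1 / Real.sqrt (2 * π)) *
        ∑' r : ℕ, (riemannZeta (1 / 2 - (r : ℂ))).re * (-β ^ 2 / 2) ^ r / r.factorial := by

  have hF' : F = fun b : ℝ => ∑' n : ℕ,
      (1 / ((n : ℝ) + 1)) * (1 / Real.sqrt (2 * π)) *
        ∫ x in Ioi (b * Real.sqrt ((n : ℝ) + 1)), Real.exp (-x ^ 2 / 2) := funext hF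
  rw [hF', (aux_deriv β hβ).deriv]
  have h1 : ∀ n : ℕ, (1 / ((n : ℝ) + 1)) * (1 / Real.sqrt (2 * π)) *
        (-Real.exp (-(β * Real.sqrt ((n : ℝ) + 1)) ^ 2 / 2) * Real.sqrt ((n : ℝ) + 1)) =
      -(1 / Real.sqrt (2 * π)) *
        (((n : ℝ) + 1) ^ (-(1 / 2 : ℝ)) * Real.exp (-(β ^ 2 / 2 * ((n:ℝ) + 1)))) := by
    intro n
    have hn : (0:ℝ) < (n:ℝ) + 1 := by positivity
    have e : -(β * Real.sqrt ((n : ℝ) + 1)) ^ 2 / 2 = -(β ^ 2 / 2 * ((n:ℝ) + 1)) := by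
      rw [mul_pow, Real.sq_sqrt hn.le]; ring
    have e2 : ((n : ℝ) + 1) ^ (-(1 / 2 : ℝ)) = 1 / ((n:ℝ) + 1) * Real.sqrt ((n : ℝ) + 1) := by
      rw [Real.rpow_neg hn.le, ← Real.sqrt_eq_rpow, one_div_mul_eq_div, Real.sqrt_div_self]
    rw [e, e2]
    ring
  rw [tsum_congr h1, tsum_mul_left, aux_final hβ hβ']
  have hs : 0 < Real.sqrt (2 * π) := by positivity
  field_simp
  ring
end

section
/- For β with 0 < β < 2√π, the identity ∑_{n=1}^∞ e^{-nβ²/2}/√(2πn) = 1/β + (1/√(2π))·∑_{r=0}^∞ ζ(1/2 − r)·(−β²/2)^r / r! holds, where ζ is the analytically continued Riemann zeta function. -/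
open Real MeasureTheory Set


lemma lap_diff : DifferentiableOn ℂ (fun r : ℂ => ∫ t in Ioi (0:ℝ), ((√t : ℝ) : ℂ) * Complex.exp (-(r * t)))
    {r : ℂ | 0 < r.re} := by
  intro r0 hr0
  have hr0 : 0 < r0.re := hr0
  apply DifferentiableAt.differentiableWithinAt
  have hmeas : ∀ r : ℂ, AEStronglyMeasurable (fun t : ℝ => ((√t : ℝ) : ℂ) * Complex.exp (-(r * t)))
      (volume.restrict (Ioi 0)) := fun r => by
    apply Continuous.aestronglyMeasurable; fun_prop
  have hnorm : ∀ (r : ℂ) (t : ℝ), ‖Complex.exp (-(r * t))‖ = Real.exp (-(r.re * t)) := by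
    intro r t; rw [Complex.norm_exp]; simp
  have key := hasDerivAt_integral_of_dominated_loc_of_deriv_le (μ := volume.restrict (Ioi (0:ℝ)))
    (F := fun (r : ℂ) (t : ℝ) => ((√t : ℝ) : ℂ) * Complex.exp (-(r * t)))
    (F' := fun (r : ℂ) (t : ℝ) => ((√t : ℝ) : ℂ) * (Complex.exp (-(r * t)) * (-t)))
    (x₀ := r0) (s := Metric.ball r0 (r0.re / 2))
    (bound := fun t => t ^ ((3:ℝ)/2) * Real.exp (-(r0.re/2) * t ^ (1:ℝ)))
    (Metric.ball_mem_nhds _ (by linarith)) (Filter.Eventually.of_forall hmeas) ?_ ?_ ?_ ?_ ?_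
  · exact key.2.differentiableAt
  · have := integrableOn_rpow_mul_exp_neg_mul_rpow (s := 1/2) (p := 1) (b := r0.re) (by norm_num) one_pos hr0
    refine Integrable.mono' this (hmeas _) (Filter.Eventually.of_forall fun t => ?_)
    rw [norm_mul, hnorm, Complex.norm_real, Real.norm_of_nonneg (Real.sqrt_nonneg _), Real.sqrt_eq_rpow]
    simp
  · apply Continuous.aestronglyMeasurable; fun_prop
  · rw [ae_restrict_iff' measurableSet_Ioi]
    refine Filter.Eventually.of_forall fun t ht r hr => ?_
    have ht : 0 < t := ht
    have h1 : r0.re / 2 < r.re := by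
      have := (Complex.abs_re_le_norm (r - r0)).trans_lt (by simpa [dist_eq_norm] using hr)
      rw [Complex.sub_re, abs_lt] at this; linarith [this.1]
    rw [norm_mul, norm_mul, hnorm, Complex.norm_real, Real.norm_of_nonneg (Real.sqrt_nonneg _), Real.sqrt_eq_rpow,
      norm_neg, Complex.norm_real, Real.norm_of_nonneg ht.le, Real.rpow_one]
    have : t ^ ((3:ℝ)/2) = t ^ ((1:ℝ)/2) * t := by
      rw [← Real.rpow_add_one ht.ne']; norm_num
    rw [this]
    have : Real.exp (-(r.re * t)) ≤ Real.exp (-(r0.re/2) * t) := by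
      apply Real.exp_le_exp.2; nlinarith
    nlinarith [mul_le_mul_of_nonneg_left this (by positivity : 0 ≤ t ^ ((1:ℝ)/2) * t)]
  · exact integrableOn_rpow_mul_exp_neg_mul_rpow (by norm_num) one_pos (by linarith)
  · refine Filter.Eventually.of_forall fun t r hr => ?_
    apply HasDerivAt.const_mul
    apply HasDerivAt.cexp
    have := (hasDerivAt_mul_const (t:ℂ) (x := r)).neg
    exact this

lemma lap_eq (r : ℂ) (hr : 0 < r.re) :
    ∫ t in Ioi (0:ℝ), ((√t : ℝ) : ℂ) * Complex.exp (-(r * t)) =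
      (r ^ (-(3/2) : ℂ)) * Complex.Gamma (3/2) := by
  have hU : IsOpen {r : ℂ | 0 < r.re} := isOpen_lt continuous_const Complex.continuous_re
  have hpre : IsPreconnected {r : ℂ | 0 < r.re} := (convex_halfSpace_re_gt 0).isPreconnected
  have h2 : DifferentiableOn ℂ (fun r : ℂ => (r ^ (-(3/2) : ℂ)) * Complex.Gamma (3/2)) {r : ℂ | 0 < r.re} := by
    intro r hr
    apply DifferentiableAt.differentiableWithinAt
    apply DifferentiableAt.mul_const
    exact (differentiableAt_id).cpow_const (Or.inl hr)
  have := AnalyticOnNhd.eqOn_of_preconnected_of_frequently_eq (lap_diff.analyticOnNhd hU)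
    (h2.analyticOnNhd hU) hpre (z₀ := 1) (by simp) ?_
  · exact this hr
  · have hfr : ∃ᶠ n : ℕ in Filter.atTop, True :=
      (Filter.Eventually.of_forall fun _ => trivial).frequently
    have ht : Filter.Tendsto (fun n : ℕ => (((1 + 1/((n:ℝ)+1) : ℝ)) : ℂ)) Filter.atTop (nhdsWithin 1 {1}ᶜ) := by
      rw [tendsto_nhdsWithin_iff]
      constructor
      · rw [show (1:ℂ) = ((1 + 0 : ℝ) : ℂ) by simp]
        apply (Complex.continuous_ofReal.tendsto _).comp
        exact tendsto_const_nhds.add tendsto_one_div_add_atTop_nhds_zero_nat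
      · refine Filter.Eventually.of_forall fun n => ?_
        simp only [mem_compl_iff, mem_singleton_iff]
        intro h
        have h : (1 + 1/((n:ℝ)+1) : ℝ) = 1 := by exact_mod_cast h
        have : (0:ℝ) < 1/((n:ℝ)+1) := by positivity
        linarith
    refine ht.frequently (hfr.mono fun n _ => ?_)
    set y : ℝ := 1 + 1/((n:ℝ)+1) with hy
    have hy0 : 0 < y := by positivity
    have := Complex.integral_cpow_mul_exp_neg_mul_Ioi (a := 3/2) (r := y) (by norm_num) hy0
    rw [one_div, Complex.inv_cpow _ _ (by rw [Complex.arg_ofReal_of_nonneg hy0.le]; exact Real.pi_pos.ne), ← Complex.cpow_neg] at this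
    rw [← this]
    apply setIntegral_congr_fun measurableSet_Ioi
    intro t ht
    have ht : 0 < t := ht
    simp only
    rw [Real.sqrt_eq_rpow, Complex.ofReal_cpow ht.le]
    norm_num

open FourierTransform in
lemma fourier_f (x : ℝ) (hx : 0 < x) (ξ : ℝ) :
    𝓕 (fun t : ℝ => ((√t * Real.exp (-(x * t)) : ℝ) : ℂ)) ξ =
      ((x : ℂ) + 2 * π * Complex.I * ξ) ^ (-(3/2) : ℂ) * Complex.Gamma (3/2) := by
  rw [Real.fourier_eq', ← lap_eq _ (by simpa using hx),
    ← integral_indicator measurableSet_Ioi]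
  congr 1
  ext t
  by_cases ht : 0 < t
  · rw [indicator_of_mem (show t ∈ Ioi 0 from ht)]
    simp only [smul_eq_mul, RCLike.inner_apply, conj_trivial]
    push_cast
    rw [mul_left_comm, ← Complex.exp_add]
    congr 2
    ring
  · rw [indicator_of_notMem (show t ∉ Ioi 0 from ht), Real.sqrt_eq_zero_of_nonpos (not_lt.1 ht)]
    simp

lemma norm_bound (x : ℝ) (hx : 0 < x) (ξ : ℝ) (hξ : ξ ≠ 0) :
    ‖((x : ℂ) + 2 * π * Complex.I * ξ) ^ (-(3/2) : ℂ)‖ ≤ |ξ| ^ (-(3/2) : ℝ) := by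
  have h0 : ((x : ℂ) + 2 * π * Complex.I * ξ) ≠ 0 := by
    intro h; have := congrArg Complex.re h; simp at this; linarith
  rw [show (-(3/2) : ℂ) = ((-(3/2) : ℝ) : ℂ) by push_cast; rfl, Complex.norm_cpow_real]
  apply Real.rpow_le_rpow_of_nonpos (abs_pos.2 hξ) _ (by norm_num)
  refine le_trans ?_ (Complex.abs_im_le_norm _)
  simp [abs_mul, abs_of_pos Real.pi_pos]
  have := Real.pi_gt_three
  nlinarith [abs_nonneg ξ]

open FourierTransform Asymptotics Filter in
lemma poisson (x : ℝ) (hx : 0 < x) :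
    ((∑' n : ℕ, √((n:ℝ)+1) * Real.exp (-(x * (n+1))) : ℝ) : ℂ) =
    ∑' k : ℤ, ((x : ℂ) + 2 * π * Complex.I * k) ^ (-(3/2) : ℂ) * Complex.Gamma (3/2) := by
  have h := Real.tsum_eq_tsum_fourier_of_rpow_decay
    (f := fun t : ℝ => ((√t * Real.exp (-(x * t)) : ℝ) : ℂ)) (by fun_prop) (b := 3/2) (by norm_num)
    ?_ ?_ 0
  · simp only [fourier_f x hx] at h
    have e : ∀ n : ℤ, fourier n (((0:ℝ)) : UnitAddCircle) = 1 := by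
      intro n; simp
    simp only [e, mul_one, zero_add, Complex.ofReal_intCast] at h
    rw [← h, ← Complex.ofReal_tsum]
    congr 1
    have hinj : Function.Injective (fun n : ℕ => ((n:ℤ)+1)) := by
      intro a b hab; simpa using hab
    rw [← hinj.tsum_eq]
    · push_cast; rfl
    · intro k hk
      have : 0 < k := by
        by_contra hk'
        apply hk
        have : (k:ℝ) ≤ 0 := by exact_mod_cast not_lt.1 hk'
        simp [Real.sqrt_eq_zero_of_nonpos this]
      exact ⟨(k-1).toNat, by simp; omega⟩
  · rw [cocompact_eq_atBot_atTop, isBigO_sup]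
    constructor
    · have : (fun t : ℝ => ((√t * Real.exp (-(x * t)) : ℝ) : ℂ)) =ᶠ[atBot] fun _ => 0 := by
        filter_upwards [eventually_le_atBot 0] with t ht
        simp [Real.sqrt_eq_zero_of_nonpos ht]
      exact this.trans_isBigO (isBigO_zero _ _)
    · have h1 := (isLittleO_exp_neg_mul_rpow_atTop hx (-2)).isBigO
      have h2 : (fun t : ℝ => √t) =O[atTop] fun t => t ^ (1/2 : ℝ) := by
        simp only [Real.sqrt_eq_rpow]; exact isBigO_refl _ _
      have h3 := h2.mul h1
      rw [← isBigO_norm_left]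
      simp only [Complex.norm_real]
      rw [isBigO_norm_left]
      refine (h3.congr' ?_ ?_)
      · exact Eventually.of_forall fun t => by simp
      · filter_upwards [eventually_gt_atTop 0] with t ht
        rw [abs_of_pos ht, ← Real.rpow_add ht]; norm_num
  · rw [isBigO_iff]
    refine ⟨‖Complex.Gamma (3/2)‖, ?_⟩
    have : ∀ᶠ ξ : ℝ in cocompact ℝ, ξ ≠ 0 := by
      have := (isCompact_singleton (x := (0:ℝ))).compl_mem_cocompact
      exact this
    filter_upwards [this] with ξ hξ
    rw [fourier_f x hx, norm_mul, mul_comm]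
    refine mul_le_mul_of_nonneg_left ?_ (norm_nonneg _)
    rw [Real.norm_of_nonneg (by positivity)]
    exact norm_bound x hx ξ hξ

lemma multi_gamma (n : ℕ) : (Ring.choose ((3/2 : ℂ) + n - 1) n) =
    ((Real.Gamma (3/2 + n) / (Real.Gamma (3/2) * n.factorial) : ℝ) : ℂ) := by
  rw [← Ring.multichoose_eq]
  have h := Ring.factorial_nsmul_multichoose_eq_ascPochhammer (3/2 : ℂ) n
  have h2 : (Polynomial.smeval (ascPochhammer ℕ n) (3/2 : ℂ)) = ((Real.Gamma (3/2 + n) / Real.Gamma (3/2) : ℝ) : ℂ) := by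
    have hg : Real.Gamma (3/2) ≠ 0 := (Real.Gamma_pos_of_pos (by norm_num)).ne'
    clear h
    induction n with
    | zero => simp [hg]
    | succ n ih =>
      rw [ascPochhammer_succ_right, Polynomial.smeval_mul, ih]
      have : Real.Gamma (3/2 + ((n+1 : ℕ):ℝ)) = (3/2 + n) * Real.Gamma (3/2 + n) := by
        rw [← Real.Gamma_add_one (by positivity)]; push_cast; ring_nf
      rw [this]
      simp [Polynomial.smeval_add, Polynomial.smeval_natCast]
      ring
  rw [h2, nsmul_eq_mul] at h
  have hf : ((n.factorial : ℕ) : ℂ) ≠ 0 := by exact_mod_cast n.factorial_ne_zero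
  rw [← div_div]
  push_cast at h ⊢
  rw [← h]
  field_simp

lemma binom (w : ℂ) (hw : ‖w‖ < 1) : HasSum (fun r : ℕ =>
    ((Real.Gamma (3/2 + r) / (Real.Gamma (3/2) * r.factorial) : ℝ) : ℂ) * (-w) ^ r)
    ((1 + w) ^ (-(3/2) : ℂ)) := by
  have h := (Complex.one_div_one_sub_cpow_hasFPowerSeriesOnBall_zero (3/2)).hasSum (y := -w) (by simpa [enorm_eq_nnnorm, ← NNReal.coe_lt_coe] using hw)
  simp only [zero_add, sub_neg_eq_add] at h
  rw [Complex.cpow_neg, ← one_div]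
  have e : (fun r : ℕ =>
      ((Real.Gamma (3/2 + r) / (Real.Gamma (3/2) * r.factorial) : ℝ) : ℂ) * (-w) ^ r) = fun n : ℕ =>
      (FormalMultilinearSeries.ofScalars ℂ (fun n : ℕ => Ring.choose ((3/2:ℂ) + n - 1) n) n) fun _ => -w := by
    ext r
    rw [← multi_gamma]
    simp [mul_comm]
  rw [e]
  exact h

lemma my_mul_cpow {a b : ℂ} (ha : a ≠ 0) (hb : b ≠ 0) (h : a.arg + b.arg ∈ Ioc (-π) π) (s : ℂ) :
    (a * b) ^ s = a ^ s * b ^ s := by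
  rw [Complex.cpow_def_of_ne_zero (mul_ne_zero ha hb), Complex.cpow_def_of_ne_zero ha,
    Complex.cpow_def_of_ne_zero hb, Complex.log_mul ha hb h, add_mul, Complex.exp_add]

lemma expand (x c : ℝ) (hx : 0 < x) (hc : x < c) : HasSum (fun r : ℕ =>
    2 * Real.cos (π * (3/2 + r) / 2) * c ^ (-(3/2 + r) : ℝ) * Real.Gamma (3/2 + r) * (-x) ^ r / r.factorial)
    (2 * Real.Gamma (3/2) * (((x:ℂ) + c * Complex.I) ^ (-(3/2) : ℂ)).re) := by
  have hc0 : 0 < c := hx.trans hc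
  have hcI : (c : ℂ) * Complex.I ≠ 0 := by simp [hc0.ne']
  set w : ℂ := x / (c * Complex.I) with hw
  have hwn : ‖w‖ < 1 := by
    rw [hw]; simp [abs_of_pos hx, abs_of_pos hc0]; rwa [div_lt_one hc0]
  have hwre : w.re = 0 := by
    rw [hw, div_mul_eq_div_div, Complex.div_I]; simp
  have hprod : (x:ℂ) + c * Complex.I = (c * Complex.I) * (1 + w) := by
    rw [hw, mul_add, mul_div_cancel₀ _ hcI]; ring
  have harg : Complex.arg (c * Complex.I) = π / 2 := by
    rw [Complex.arg_real_mul _ hc0, Complex.arg_I]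
  have hpow : ((x:ℂ) + c * Complex.I) ^ (-(3/2) : ℂ) = (c * Complex.I) ^ (-(3/2) : ℂ) * (1 + w) ^ (-(3/2) : ℂ) := by
    have hw1 : 1 + w ≠ 0 := by
      intro h; have := congrArg Complex.re h; simp [hwre] at this
    rw [hprod, my_mul_cpow hcI hw1]
    have h1 : |Complex.arg (1 + w)| < π / 2 := by
      rw [Complex.abs_arg_lt_pi_div_two_iff]; left; simp [hwre]
    rw [abs_lt] at h1
    rw [harg]
    constructor <;> linarith [h1.1, h1.2, Real.pi_pos]
  have h := (binom w hwn).mul_left (2 * (Real.Gamma (3/2):ℂ) * (c * Complex.I) ^ (-(3/2) : ℂ))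
  rw [mul_assoc _ _ ((1 + w) ^ (-(3/2) : ℂ)), ← hpow] at h
  have h := Complex.hasSum_re h
  convert h using 1
  · ext r
    have hg : Real.Gamma (3/2) ≠ 0 := (Real.Gamma_pos_of_pos (by norm_num)).ne'
    have e1 : (c * Complex.I) ^ (-(3/2) : ℂ) * (-w)^r = (((c ^ (-(3/2 + r) : ℝ) * (-x)^r : ℝ)) : ℂ) * 
        Complex.exp ((-(π * (3/2 + r) / 2) : ℝ) * Complex.I) := by
      have : (-w)^r = (-x:ℂ)^r * (c * Complex.I) ^ (-(r:ℂ)) := by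
        rw [Complex.cpow_neg, Complex.cpow_natCast, hw, ← neg_div, div_pow, div_eq_mul_inv]
      rw [this, mul_left_comm, ← Complex.cpow_add _ _ hcI]
      push_cast
      rw [mul_comm (((c ^ (-(3/2 + r) : ℝ) : ℝ)) : ℂ), mul_assoc]
      congr 1
      rw [show (-(3/2) + -(r:ℂ)) = ((-(3/2 + r) : ℝ) : ℂ) by push_cast; ring]
      have : (-(3/2 + r) : ℂ) = ((-(3/2 + r) : ℝ) : ℂ) := by push_cast; ring
      rw [Complex.ofReal_cpow hc0.le, my_mul_cpow (by exact_mod_cast hc0.ne') Complex.I_ne_zero (by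
        rw [Complex.arg_ofReal_of_nonneg hc0.le, Complex.arg_I]; constructor <;> linarith [Real.pi_pos])]
      congr 1
      rw [Complex.cpow_def_of_ne_zero Complex.I_ne_zero, Complex.log_I]
      congr 1
      push_cast; ring
    rw [show ∀ (A B C D : ℂ), A * B * (C * D) = A * C * (B * D) by intros; ring, e1, ← mul_assoc]
    have : (2 * (Real.Gamma (3/2):ℂ) * ((Real.Gamma (3/2 + r) / (Real.Gamma (3/2) * r.factorial) : ℝ) : ℂ) * 
      (((c ^ (-(3/2 + r) : ℝ) * (-x)^r : ℝ)) : ℂ)) = ((2 * Real.Gamma (3/2) * (Real.Gamma (3/2 + r) / (Real.Gamma (3/2) * r.factorial)) * (c ^ (-(3/2 + r) : ℝ) * (-x)^r) : ℝ) : ℂ) := by push_cast; ring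
    rw [this, Complex.re_ofReal_mul, Complex.exp_ofReal_mul_I_re, Real.cos_neg]
    have := r.factorial_ne_zero
    field_simp
  · rw [show (2 * (Real.Gamma (3/2):ℂ)) = ((2 * Real.Gamma (3/2) : ℝ) : ℂ) by push_cast; ring, Complex.re_ofReal_mul]

lemma gamma_bound (r : ℕ) : Real.Gamma (3/2 + r) / r.factorial ≤ Real.Gamma (3/2) * (r+1) := by
  induction r with
  | zero => simp
  | succ r ih =>
    have : Real.Gamma (3/2 + ((r+1 : ℕ):ℝ)) = (3/2 + r) * Real.Gamma (3/2 + r) := by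
      rw [← Real.Gamma_add_one (by positivity)]; push_cast; ring_nf
    rw [this, Nat.factorial_succ]
    push_cast
    have hg : 0 < Real.Gamma (3/2) := (Real.Gamma_pos_of_pos (by norm_num))
    calc (3/2 + r) * Real.Gamma (3/2 + r) / ((r+1) * r.factorial)
        = (3/2 + r) / (r+1) * (Real.Gamma (3/2 + r) / r.factorial) := by field_simp
      _ ≤ (3/2 + r) / (r+1) * (Real.Gamma (3/2) * (r+1)) := by gcongr
      _ = (3/2 + r) * Real.Gamma (3/2) := by field_simp
      _ ≤ _ := by nlinarith

lemma zeta_half (r : ℕ) : HasSum (fun k : ℕ => 2 * Real.cos (π * (3/2 + r) / 2) * (2 * π * (k+1)) ^ (-(3/2 + r) : ℝ) * Real.Gamma (3/2 + r)) (riemannZeta (1/2 - ((r+1 : ℕ) : ℂ))).re := by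
  set s : ℝ := 3/2 + r with hs
  have hs1 : 1 < s := by rw [hs]; have : (0:ℝ) ≤ r := by positivity
                         linarith
  have h1 : riemannZeta (1/2 - ((r+1 : ℕ) : ℂ)) = 2 * (2 * π) ^ (-(s:ℂ)) * Complex.Gamma s * Complex.cos (π * s / 2) * riemannZeta s := by
    rw [← riemannZeta_one_sub]
    · rw [hs]; push_cast; ring_nf
    · intro n h
      have h : s = -n := by exact_mod_cast h
      have : (0:ℝ) ≤ n := by positivity
      linarith
    · intro h
      have h : s = 1 := by exact_mod_cast h
      linarith
  have hsum : Summable (fun k : ℕ => ((k:ℝ)+1) ^ (-s)) := by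
    have := (summable_nat_add_iff 1).2 (Real.summable_nat_rpow.2 (show -s < -1 by linarith))
    simpa using this
  have h2 : riemannZeta s = ((∑' k : ℕ, ((k:ℝ)+1) ^ (-s) : ℝ) : ℂ) := by
    rw [zeta_eq_tsum_one_div_nat_add_one_cpow (by simpa using hs1), Complex.ofReal_tsum]
    congr 1; ext k
    rw [Complex.ofReal_cpow (by positivity), Complex.ofReal_neg, Complex.cpow_neg]
    push_cast; rw [one_div]
  have h3 : (riemannZeta (1/2 - ((r+1 : ℕ) : ℂ))).re = 2 * (2 * π) ^ (-s) * Real.Gamma s * Real.cos (π * s / 2) * ∑' k : ℕ, ((k:ℝ)+1) ^ (-s) := by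
    rw [h1, h2, Complex.Gamma_ofReal]
    have : (2 * (π:ℂ)) ^ (-(s:ℂ)) = (((2 * π) ^ (-s) : ℝ) : ℂ) := by
      rw [Complex.ofReal_cpow (by positivity)]; push_cast; rfl
    rw [this]
    have : Complex.cos (π * s / 2) = ((Real.cos (π * s / 2) : ℝ) : ℂ) := by push_cast; rfl
    rw [this]
    norm_cast
  rw [h3]
  have := hsum.hasSum.mul_left (2 * (2 * π) ^ (-s) * Real.Gamma s * Real.cos (π * s / 2))
  convert! this using 1
  ext k
  rw [Real.mul_rpow (by positivity) (by positivity)]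
  ring
lemma summ_k : Summable (fun k : ℕ => ((k:ℝ)+1) ^ (-(3/2) : ℝ)) := by
  have := (summable_nat_add_iff 1).2 (Real.summable_nat_rpow.2 (show (-(3/2) : ℝ) < -1 by norm_num))
  simpa using this

lemma T_bound (k r : ℕ) : |2 * Real.cos (π * (3/2 + r) / 2) * (2 * π * (k+1)) ^ (-(3/2 + r) : ℝ) * Real.Gamma (3/2 + r)|
    ≤ ((k:ℝ)+1) ^ (-(3/2) : ℝ) * (2 * Real.Gamma (3/2) * ((r+1) * ((2 * π) ^ r)⁻¹ * r.factorial)) := by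
  have hg : 0 < Real.Gamma (3/2) := (Real.Gamma_pos_of_pos (by norm_num))
  have hg' : 0 < Real.Gamma (3/2 + r) := (Real.Gamma_pos_of_pos (by positivity))
  have hb := gamma_bound r
  rw [div_le_iff₀ (by positivity)] at hb
  have hpi := Real.pi_gt_three
  have hk : (0:ℝ) < k + 1 := by positivity
  have e : (2 * π * ((k:ℝ)+1)) ^ (-(3/2 + r) : ℝ) ≤ ((k:ℝ)+1) ^ (-(3/2) : ℝ) * ((2 * π) ^ r)⁻¹ := by
    rw [neg_add, Real.rpow_add (by positivity), Real.rpow_neg _ (r:ℝ), Real.rpow_natCast]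
    · gcongr ?_ * ?_
      · apply Real.rpow_le_rpow_of_nonpos hk _ (by norm_num)
        nlinarith
      · refine inv_anti₀ (by positivity) (pow_le_pow_left₀ (by positivity) ?_ r)
        nlinarith [(by positivity : (0:ℝ) ≤ k)]
    · positivity
  rw [abs_mul, abs_mul, abs_mul, abs_of_pos hg', abs_two, abs_of_pos (Real.rpow_pos_of_pos (by positivity) _)]
  calc 2 * |Real.cos (π * (3/2 + r) / 2)| * (2 * π * ((k:ℝ)+1)) ^ (-(3/2 + r) : ℝ) * Real.Gamma (3/2 + r)
      ≤ 2 * 1 * (((k:ℝ)+1) ^ (-(3/2) : ℝ) * ((2 * π) ^ r)⁻¹) * (Real.Gamma (3/2) * (r+1) * r.factorial) := by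
        gcongr
        exact Real.abs_cos_le_one _
    _ = _ := by ring

lemma zeta_bound : ∃ C : ℝ, 0 ≤ C ∧ ∀ r : ℕ, |(riemannZeta (1/2 - ((r+1 : ℕ) : ℂ))).re| ≤ C * ((r+1) * ((2 * π) ^ r)⁻¹ * r.factorial) := by
  have hg : 0 < Real.Gamma (3/2) := (Real.Gamma_pos_of_pos (by norm_num))
  refine ⟨(∑' k : ℕ, ((k:ℝ)+1) ^ (-(3/2) : ℝ)) * (2 * Real.Gamma (3/2)), 
    mul_nonneg (tsum_nonneg fun k => by positivity) (by positivity), fun r => ?_⟩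
  rw [← (zeta_half r).tsum_eq, mul_assoc, ← tsum_mul_right, ← Real.norm_eq_abs]
  exact tsum_of_norm_bounded (summ_k.mul_right _).hasSum fun k => T_bound k r

lemma summ_r (q : ℝ) (h0 : 0 ≤ q) (h1 : q < 2 * π) : Summable (fun r : ℕ => ((r:ℝ)+1) * (((2 * π) ^ r)⁻¹ * q ^ r)) := by
  have hq : ‖q / (2 * π)‖ < 1 := by
    rw [Real.norm_of_nonneg (by positivity), div_lt_one (by positivity)]; exact h1
  have := (summable_pow_mul_geometric_of_norm_lt_one 1 hq).add (summable_geometric_of_norm_lt_one hq)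
  refine this.congr fun r => ?_
  rw [div_pow]; field_simp

lemma lerch_deriv_id (x : ℝ) (hx : 0 < x) (hx' : x < 2 * π) :
    ∑' n : ℕ, √((n:ℝ)+1) * Real.exp (-(x * (n+1))) = Real.Gamma (3/2) * x ^ (-(3/2) : ℝ) +
      ∑' r : ℕ, (riemannZeta (1/2 - ((r+1 : ℕ) : ℂ))).re * (-x) ^ r / r.factorial := by
  have hg : 0 < Real.Gamma (3/2) := (Real.Gamma_pos_of_pos (by norm_num))
  have hGam : Complex.Gamma (3/2) = ((Real.Gamma (3/2) : ℝ) : ℂ) := by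
    rw [← Complex.Gamma_ofReal]; push_cast; rfl
  have hp := poisson x hx
  set f : ℤ → ℂ := fun k => ((x : ℂ) + 2 * π * Complex.I * k) ^ (-(3/2) : ℂ) * Complex.Gamma (3/2) with hf
  have hfb : ∀ k : ℤ, k ≠ 0 → ‖f k‖ ≤ |(k:ℝ)| ^ (-(3/2) : ℝ) * ‖Complex.Gamma (3/2)‖ := by
    intro k hk
    rw [hf]; simp only [norm_mul]
    gcongr
    have := norm_bound x hx k (by exact_mod_cast hk)
    simpa using this
  have s1 : Summable (fun n : ℕ => f (n + 1)) := by
    refine Summable.of_norm_bounded (summ_k.mul_right ‖Complex.Gamma (3/2)‖) fun n => ?_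
    refine (hfb _ (by omega)).trans_eq ?_
    push_cast
    rw [abs_of_pos (by positivity)]
  have s2 : Summable (fun n : ℕ => f (-(n + 1 : ℤ))) := by
    refine Summable.of_norm_bounded (summ_k.mul_right ‖Complex.Gamma (3/2)‖) fun n => ?_
    refine (hfb _ (by omega)).trans_eq ?_
    push_cast
    rw [abs_neg, abs_of_pos (by positivity)]
  have hsum := (HasSum.of_add_one_of_neg_add_one s1.hasSum s2.hasSum).tsum_eq
  rw [hsum, ← add_right_comm] at hp
  have hre := congrArg Complex.re hp
  rw [Complex.ofReal_re, Complex.add_re, ← Summable.tsum_add s1 s2, Complex.re_tsum (s1.add s2)] at hre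
  rw [hre, add_comm]
  congr 1
  · rw [hf]
    simp only [Int.cast_zero, mul_zero, add_zero]
    rw [show (-(3/2) : ℂ) = ((-(3/2) : ℝ) : ℂ) by push_cast; rfl, ← Complex.ofReal_cpow hx.le, hGam,
      ← Complex.ofReal_mul, Complex.ofReal_re, mul_comm]
  · have hk : ∀ k : ℕ, (f (k+1) + f (-(k+1 : ℤ))).re = ∑' r : ℕ, 2 * Real.cos (π * (3/2 + r) / 2) * (2 * π * (k+1)) ^ (-(3/2 + r) : ℝ) * Real.Gamma (3/2 + r) * (-x) ^ r / r.factorial := by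
      intro k
      have hk0 : (0:ℝ) ≤ k := by positivity
      have hc : x < 2 * π * (k + 1) := by nlinarith [Real.pi_pos]
      rw [(expand x (2 * π * (k+1)) hx hc).tsum_eq]
      have e1 : f (k+1) = ((x:ℂ) + (2 * π * (k+1) : ℝ) * Complex.I) ^ (-(3/2) : ℂ) * (Real.Gamma (3/2) : ℝ) := by
        rw [hf, hGam]; push_cast; ring_nf
      have e2 : f (-(k+1 : ℤ)) = (starRingEnd ℂ) (f (k+1)) := by
        have hcs : (starRingEnd ℂ) (-(3/2) : ℂ) = -(3/2) := by
          rw [show (-(3/2) : ℂ) = ((-(3/2) : ℝ) : ℂ) by push_cast; rfl, Complex.conj_ofReal]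
        have hcc := Complex.conj_cpow ((x:ℂ) + (2 * π * (k+1) : ℝ) * Complex.I) (-(3/2)) ?_
        · rw [hcs] at hcc
          rw [e1, map_mul, Complex.conj_ofReal, ← hcc, hf, hGam]
          simp only [map_add, map_mul, Complex.conj_ofReal, Complex.conj_I, map_neg, map_div₀, map_ofNat]
          push_cast; ring_nf
        · have : |Complex.arg ((x:ℂ) + (2 * π * (k+1) : ℝ) * Complex.I)| < π / 2 := by
            rw [Complex.abs_arg_lt_pi_div_two_iff]; left; simp [hx]
          intro h
          rw [h, abs_of_pos Real.pi_pos] at this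
          linarith [Real.pi_pos]
      rw [Complex.add_re, e2, Complex.conj_re, e1, mul_comm _ ((Real.Gamma (3/2) : ℝ) : ℂ), Complex.re_ofReal_mul]
      ring
    simp_rw [hk]
    rw [Summable.tsum_comm]
    · congr 1
      ext r
      rw [← (zeta_half r).tsum_eq, ← tsum_mul_right, ← tsum_div_const]
    · have := Summable.mul_of_nonneg summ_k ((summ_r x hx.le hx').mul_left (2 * Real.Gamma (3/2))) (fun k => by positivity) (fun k => by positivity)
      refine Summable.of_norm_bounded this.prod_symm fun p => ?_
      obtain ⟨r, k⟩ := p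
      simp only [Function.uncurry, Prod.swap]
      rw [norm_div, norm_mul, Real.norm_eq_abs, norm_pow, norm_neg, Real.norm_of_nonneg hx.le, Real.norm_natCast,
        div_le_iff₀ (by positivity)]
      refine (mul_le_mul_of_nonneg_right (T_bound k r) (by positivity)).trans_eq ?_
      ring

lemma b_summ (x q : ℝ) (h0 : |x| ≤ q) (h1 : q < 2 * π) : ∃ u : ℕ → ℝ, Summable u ∧ ∀ (y : ℝ), |y| ≤ q → ∀ r : ℕ,
    ‖(riemannZeta (1/2 - ((r+1 : ℕ) : ℂ))).re * (-y) ^ r / r.factorial‖ ≤ u r := by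
  obtain ⟨C, hC, h⟩ := zeta_bound
  have hq : 0 ≤ q := (abs_nonneg x).trans h0
  refine ⟨_, (summ_r q hq h1).mul_left C, fun y hy r => ?_⟩
  rw [norm_div, norm_mul, norm_pow, norm_neg, Real.norm_eq_abs, Real.norm_eq_abs, Real.norm_natCast, div_le_iff₀ (by positivity)]
  calc _ ≤ C * ((r+1) * ((2 * π) ^ r)⁻¹ * r.factorial) * q ^ r := by
        gcongr; exact h r
    _ = _ := by ring

/-- The power series. -/
lemma R_deriv (x : ℝ) (hx : |x| < 2 * π) :
    HasDerivAt (fun y : ℝ => ∑' r : ℕ, (riemannZeta (1/2 - (r : ℂ))).re * (-y) ^ r / r.factorial)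
      (- ∑' r : ℕ, (riemannZeta (1/2 - ((r+1 : ℕ) : ℂ))).re * (-x) ^ r / r.factorial) x := by
  obtain ⟨q, hq1, hq2⟩ := exists_between hx
  obtain ⟨u, hu, hub⟩ := b_summ x q hq1.le hq2
  have hq : 0 < q := (abs_nonneg x).trans_lt hq1
  have hfact : ∀ r : ℕ, ∀ y : ℝ, HasDerivAt (fun y : ℝ => (riemannZeta (1/2 - ((r+1 : ℕ) : ℂ))).re * (-y) ^ (r+1) / (r+1).factorial)
      (-((riemannZeta (1/2 - ((r+1 : ℕ) : ℂ))).re * (-y) ^ r / r.factorial)) y := by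
    intro r y
    have h1 := (((hasDerivAt_neg y).pow (r+1)).const_mul (riemannZeta (1/2 - ((r+1 : ℕ) : ℂ))).re).div_const ((r+1).factorial : ℝ)
    convert! h1 using 1
    rw [Nat.factorial_succ]; push_cast; field_simp
  have hd := hasDerivAt_tsum_of_isPreconnected (t := Ioo (-q) q) hu isOpen_Ioo isPreconnected_Ioo
    (fun r y _ => hfact r y) (fun r y hy => by rw [norm_neg]; exact hub y (abs_le.2 ⟨hy.1.le, hy.2.le⟩) r)
    (y₀ := 0) (by simp [hq]) (by simp [summable_zero]) (y := x) (abs_lt.1 hq1)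
  rw [tsum_neg] at hd
  have hd := hd.const_add ((riemannZeta (1/2)).re)
  refine hd.congr_of_eventuallyEq ?_
  filter_upwards [Ioo_mem_nhds (abs_lt.1 hq1).1 (abs_lt.1 hq1).2] with y hy
  have hs : Summable fun r : ℕ => (riemannZeta (1/2 - ((r+1 : ℕ) : ℂ))).re * (-y) ^ (r+1) / (r+1).factorial := by
    refine Summable.of_norm_bounded (hu.mul_right |y|) fun r => ?_
    have := hub y (abs_le.2 ⟨hy.1.le, hy.2.le⟩) r
    refine le_trans ?_ (mul_le_mul_of_nonneg_right this (abs_nonneg y))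
    rw [← Real.norm_eq_abs, ← norm_mul, ]
    have e : (riemannZeta (1/2 - ((r+1 : ℕ) : ℂ))).re * (-y) ^ (r+1) / (r+1).factorial = (-1/(r+1)) * ((riemannZeta (1/2 - ((r+1 : ℕ) : ℂ))).re * (-y) ^ r / r.factorial * y) := by
      rw [Nat.factorial_succ]; push_cast; field_simp; ring
    rw [e, norm_mul]
    apply mul_le_of_le_one_left (norm_nonneg _)
    rw [norm_div, norm_neg, norm_one, Real.norm_of_nonneg (by positivity), div_le_one (by positivity)]
    linarith [(by positivity : (0:ℝ) ≤ r)]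
  have hs' := (summable_nat_add_iff (f := fun r : ℕ => (riemannZeta (1/2 - (r : ℂ))).re * (-y) ^ r / r.factorial) 1).1 hs
  rw [hs'.tsum_eq_zero_add]
  simp

lemma A_deriv (x : ℝ) (hx : 0 < x) :
    HasDerivAt (fun y : ℝ => ∑' n : ℕ, Real.exp (-(y * (n+1))) / √((n:ℝ)+1))
      (- ∑' n : ℕ, √((n:ℝ)+1) * Real.exp (-(x * (n+1)))) x := by
  have hsum : ∀ ε : ℝ, 0 < ε → Summable fun n : ℕ => ((n:ℝ)+1) * Real.exp (-(ε * (n+1))) := by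
    intro ε hε
    have := (summable_nat_add_iff 1).2 (Real.summable_pow_mul_exp_neg_nat_mul 1 hε)
    refine this.congr fun n => ?_
    push_cast; rw [pow_one]; ring_nf
  have hd := hasDerivAt_tsum_of_isPreconnected (t := Ioi (x/2)) (hsum (x/2) (by linarith)) isOpen_Ioi isPreconnected_Ioi
    (g := fun (n : ℕ) (y : ℝ) => Real.exp (-(y * (n+1))) / √((n:ℝ)+1))
    (g' := fun (n : ℕ) (y : ℝ) => -(√((n:ℝ)+1) * Real.exp (-(y * (n+1)))))
    (y₀ := x) (y := x) ?_ ?_ (by simp [hx]) ?_ (by simp [hx])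
  · rw [tsum_neg] at hd
    exact hd
  · intro n y hy
    have h1 := ((hasDerivAt_mul_const ((n:ℝ)+1) (x := y)).neg.exp).div_const (√((n:ℝ)+1))
    convert! h1 using 1
    have : (√((n:ℝ)+1)) ≠ 0 := by positivity
    field_simp
    rw [Real.sq_sqrt (by positivity)]
    simp
  · intro n y hy
    have hy : x/2 < y := hy
    rw [norm_neg, Real.norm_of_nonneg (by positivity)]
    gcongr
    rw [Real.sqrt_le_left (by positivity)]
    nlinarith [(by positivity : (0:ℝ) ≤ n)]
  · refine Summable.of_norm_bounded (hsum x hx) fun n => ?_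
    rw [Real.norm_of_nonneg (by positivity), div_le_iff₀ (by positivity)]
    have : 1 ≤ √((n:ℝ)+1) := by rw [Real.one_le_sqrt]; linarith [(by positivity : (0:ℝ) ≤ n)]
    have h2 : (1:ℝ) ≤ (n+1) * √((n:ℝ)+1) := by nlinarith [(by positivity : (0:ℝ) ≤ n)]
    nlinarith [Real.exp_pos (-(x * ((n:ℝ)+1)))]
lemma q_bound (a : ℝ) (ha : 1 ≤ a) (s : ℂ) (hs : 1/4 < s.re) (hs' : ‖s‖ < 3) :
    ‖(s-1) * (a:ℂ) ^ (-s) + ((a+1 : ℝ) : ℂ) ^ (1-s) - (a:ℂ) ^ (1-s)‖ ≤ 12 * a ^ (-(5/4) : ℝ) := by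
  have ha0 : 0 < a := by linarith
  have hd : ∀ (w : ℂ) (t : ℝ), t ∈ Icc a (a+1) → HasDerivAt (fun y : ℝ => (y:ℂ) ^ w) (w * (t:ℂ) ^ (w - 1)) t := by
    intro w t ht
    have ht0 : 0 < t := by linarith [ht.1]
    have := ((hasDerivAt_id (t:ℂ)).cpow_const (c := w) (Or.inl (by simpa using ht0))).comp_ofReal
    simpa using this
  have hnorm : ∀ (w : ℂ) (t : ℝ), 0 < t → ‖(t:ℂ) ^ w‖ = t ^ w.re := fun w t ht =>
    Complex.norm_cpow_eq_rpow_re_of_pos ht w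
  have h1 : ∀ t ∈ Icc a (a+1), ‖(t:ℂ) ^ (-s) - (a:ℂ) ^ (-s)‖ ≤ 3 * a ^ (-(5/4) : ℝ) := by
    intro t ht
    have := norm_image_sub_le_of_norm_deriv_le_segment' (f := fun y : ℝ => (y:ℂ) ^ (-s)) (a := a) (b := a+1)
      (C := 3 * a ^ (-(5/4) : ℝ))
      (fun t ht => (hd (-s) t ht).hasDerivWithinAt) ?_ t ht
    · refine this.trans ?_
      apply mul_le_of_le_one_right (by positivity); linarith [ht.2]
    · intro t ht
      have ht0 : 0 < t := by linarith [ht.1]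
      rw [norm_mul, norm_neg, hnorm _ _ ht0]
      gcongr
      have e : (-s - 1).re = -(s.re + 1) := by simp; ring
      rw [e]
      calc t ^ (-(s.re + 1)) ≤ a ^ (-(s.re + 1)) := Real.rpow_le_rpow_of_nonpos ha0 ht.1 (by linarith)
        _ ≤ _ := Real.rpow_le_rpow_of_exponent_le ha (by linarith)
  have h2 := norm_image_sub_le_of_norm_deriv_le_segment' (f := fun y : ℝ => (y:ℂ) ^ (1-s) - (y:ℂ) * ((1 - s) * (a:ℂ) ^ (-s))) (a := a) (b := a+1)
      (f' := fun t => (1-s) * (t:ℂ) ^ (1 - s - 1) - 1 * ((1 - s) * (a:ℂ) ^ (-s)))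
      (C := 4 * (3 * a ^ (-(5/4) : ℝ)))
      (fun t ht => ((hd (1-s) t ht).sub ((hasDerivAt_id (t:ℂ)).comp_ofReal.mul_const _)).hasDerivWithinAt) ?_ (a+1) (by simp)
  · have e : (s-1) * (a:ℂ) ^ (-s) + ((a+1 : ℝ) : ℂ) ^ (1-s) - (a:ℂ) ^ (1-s) = (((a+1 : ℝ) : ℂ) ^ (1-s) - ((a+1 : ℝ) : ℂ) * ((1 - s) * (a:ℂ) ^ (-s))) - ((a : ℂ) ^ (1-s) - (a : ℂ) * ((1 - s) * (a:ℂ) ^ (-s))) := by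
      push_cast; ring
    rw [e]
    refine h2.trans_eq ?_
    ring
  · intro t ht
    have e : (1-s) * (t:ℂ) ^ (1 - s - 1) - 1 * ((1 - s) * (a:ℂ) ^ (-s)) = (1 - s) * ((t:ℂ) ^ (-s) - (a:ℂ) ^ (-s)) := by
      rw [show 1 - s - 1 = -s by ring]; ring
    rw [e, norm_mul]
    have h3 : ‖1 - s‖ ≤ 4 := (norm_sub_le _ _).trans (by rw [norm_one]; linarith)
    exact mul_le_mul h3 (h1 t (Ico_subset_Icc_self ht)) (norm_nonneg _) (by norm_num)

lemma summ_54 : Summable (fun k : ℕ => 12 * ((k:ℝ)+1) ^ (-(5/4) : ℝ)) := by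
  have := (summable_nat_add_iff 1).2 (Real.summable_nat_rpow.2 (show (-(5/4) : ℝ) < -1 by norm_num))
  simpa using this.mul_left 12

lemma zeta1_eq (s : ℂ) (hs : 1/4 < s.re) (hs' : ‖s‖ < 3) : riemannZeta₁ s = 1 + ∑' n : ℕ,
    ((s-1) * ((n + 1 : ℝ):ℂ) ^ (-s) + ((n+1+1 : ℝ) : ℂ) ^ (1-s) - ((n+1 : ℝ):ℂ) ^ (1-s)) := by
  set U : Set ℂ := {s : ℂ | 1/4 < s.re} ∩ Metric.ball 0 3 with hU
  have hUo : IsOpen U := (isOpen_lt continuous_const Complex.continuous_re).inter Metric.isOpen_ball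
  have hpre : IsPreconnected U := ((convex_halfSpace_re_gt (1/4)).inter (convex_ball 0 3)).isPreconnected
  have hb : ∀ (n : ℕ) (s : ℂ), s ∈ U → ‖((s-1) * ((n + 1 : ℝ):ℂ) ^ (-s) + ((n+1+1 : ℝ) : ℂ) ^ (1-s) - ((n+1 : ℝ):ℂ) ^ (1-s))‖ ≤ 12 * ((n:ℝ)+1) ^ (-(5/4) : ℝ) := by
    intro n s hs
    exact q_bound _ (by linarith [(by positivity : (0:ℝ) ≤ n)]) s hs.1 (by simpa using hs.2)
  have hne : ∀ n : ℕ, ((n + 1 : ℝ):ℂ) ≠ 0 := fun n => by exact_mod_cast n.succ_ne_zero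
  have hne2 : ∀ n : ℕ, ((n + 1 + 1 : ℝ):ℂ) ≠ 0 := fun n => by exact_mod_cast (n+1).succ_ne_zero
  have hdiff : DifferentiableOn ℂ (fun s : ℂ => 1 + ∑' n : ℕ,
    ((s-1) * ((n + 1 : ℝ):ℂ) ^ (-s) + ((n+1+1 : ℝ) : ℂ) ^ (1-s) - ((n+1 : ℝ):ℂ) ^ (1-s))) U := by
    apply DifferentiableOn.const_add
    refine Complex.differentiableOn_tsum_of_summable_norm summ_54 (fun n => ?_) hUo hb
    apply Differentiable.differentiableOn
    intro s
    have d1 : DifferentiableAt ℂ (fun s : ℂ => ((n + 1 : ℝ):ℂ) ^ (-s)) s := 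
      (differentiableAt_id.neg).const_cpow (Or.inl (hne n))
    have d2 : DifferentiableAt ℂ (fun s : ℂ => ((n + 1 + 1 : ℝ):ℂ) ^ (1-s)) s := 
      (differentiableAt_id.const_sub 1).const_cpow (Or.inl (hne2 n))
    have d3 : DifferentiableAt ℂ (fun s : ℂ => ((n + 1 : ℝ):ℂ) ^ (1-s)) s := 
      (differentiableAt_id.const_sub 1).const_cpow (Or.inl (hne n))
    exact (((differentiableAt_id.sub_const 1).mul d1).add d2).sub d3
  have key := AnalyticOnNhd.eqOn_of_preconnected_of_eventuallyEq
    ((differentiable_riemannZeta₁.differentiableOn (s := U)).analyticOnNhd hUo) (hdiff.analyticOnNhd hUo) hpre (z₀ := 2)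
    (by simp [hU]; norm_num) ?_
  · exact key ⟨hs, by simpa using hs'⟩
  · have hUn : U ∩ {s : ℂ | 1 < s.re} ∈ nhds (2:ℂ) := by
      apply (hUo.inter (isOpen_lt continuous_const Complex.continuous_re)).mem_nhds
      simp [hU]; norm_num
    filter_upwards [hUn] with s hs
    have hs1 : 1 < s.re := hs.2
    have hne1 : s ≠ 1 := by intro h; rw [h] at hs1; simp at hs1
    have hz1 : riemannZeta₁ s = (s - 1) * riemannZeta s := by
      rw [riemannZeta_eq_inv_sub_mul hne1, mul_inv_cancel_left₀ (sub_ne_zero.2 hne1)]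
    have hq : Summable fun n : ℕ => ((s-1) * ((n + 1 : ℝ):ℂ) ^ (-s) + ((n+1+1 : ℝ) : ℂ) ^ (1-s) - ((n+1 : ℝ):ℂ) ^ (1-s)) :=
      Summable.of_norm_bounded summ_54 fun n => hb n s hs.1
    have hz : HasSum (fun n : ℕ => (s-1) * ((n + 1 : ℝ):ℂ) ^ (-s)) ((s - 1) * riemannZeta s) := by
      apply HasSum.mul_left
      rw [zeta_eq_tsum_one_div_nat_add_one_cpow hs1]
      have : Summable fun n : ℕ => 1 / ((n:ℂ) + 1) ^ s := by
        have := (summable_nat_add_iff 1).2 (Complex.summable_one_div_nat_cpow.2 hs1)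
        simpa using this
      convert! this.hasSum using 1
      ext n
      rw [Complex.cpow_neg]; push_cast; rw [one_div]
    have htel := hq.sub hz.summable
    have hT := htel.hasSum.tendsto_sum_nat
    have hT2 : Filter.Tendsto (fun N : ℕ => ((N+1 : ℝ) : ℂ) ^ (1-s) - 1) Filter.atTop (nhds (0 - 1)) := by
      apply Filter.Tendsto.sub_const
      rw [tendsto_zero_iff_norm_tendsto_zero]
      have : ∀ N : ℕ, ‖((N+1 : ℝ) : ℂ) ^ (1-s)‖ = ((N:ℝ)+1) ^ (-(s.re - 1)) := by
        intro N
        rw [Complex.norm_cpow_eq_rpow_re_of_pos (by positivity)]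
        simp
      simp_rw [this]
      exact (tendsto_rpow_neg_atTop (by linarith)).comp (Filter.tendsto_atTop_add_const_right _ _ tendsto_natCast_atTop_atTop)
    have heq : ∀ N : ℕ, ∑ i ∈ Finset.range N, (((s-1) * ((i + 1 : ℝ):ℂ) ^ (-s) + ((i+1+1 : ℝ) : ℂ) ^ (1-s) - ((i+1 : ℝ):ℂ) ^ (1-s)) - (s-1) * ((i + 1 : ℝ):ℂ) ^ (-s)) = ((N+1 : ℝ) : ℂ) ^ (1-s) - 1 := by
      intro N
      have := Finset.sum_range_sub (fun i : ℕ => ((i+1 : ℝ) : ℂ) ^ (1-s)) N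
      simp only [Nat.cast_zero, zero_add, Complex.ofReal_one, Complex.one_cpow] at this
      rw [← this]
      apply Finset.sum_congr rfl
      intro i _
      push_cast; ring
    simp_rw [heq] at hT
    have := tendsto_nhds_unique hT hT2
    rw [hq.tsum_sub hz.summable, hz.tsum_eq, sub_eq_iff_eq_add] at this
    rw [this, hz1]; ring

lemma zeta_const : (riemannZeta (1/2)).re = -2 + ∑' n : ℕ, (1 / √((n:ℝ)+1) - 2 * (√((n:ℝ)+2) - √((n:ℝ)+1))) := by
  have h := zeta1_eq (1/2) (by norm_num) (by norm_num)
  have hpow : ∀ a : ℝ, 0 ≤ a → ((a:ℂ) ^ (1 - 1/2 : ℂ)) = ((√a : ℝ) : ℂ) := by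
    intro a ha
    rw [Real.sqrt_eq_rpow, Complex.ofReal_cpow ha]; norm_num
  have hpow2 : ∀ a : ℝ, 0 ≤ a → ((a:ℂ) ^ (-(1/2) : ℂ)) = ((1/√a : ℝ) : ℂ) := by
    intro a ha
    have h1 : (1/√a : ℝ) = a ^ (-(1/2) : ℝ) := by
      rw [Real.sqrt_eq_rpow, Real.rpow_neg ha, one_div (a ^ _)]
    rw [h1, Complex.ofReal_cpow ha]; norm_num
  have hz : riemannZeta (1/2) = ((-2 + ∑' n : ℕ, (1 / √((n:ℝ)+1) - 2 * (√((n:ℝ)+2) - √((n:ℝ)+1))) : ℝ) : ℂ) := by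
    rw [riemannZeta_eq_inv_sub_mul (by norm_num), h, mul_add, ← tsum_mul_left]
    rw [Complex.ofReal_add, Complex.ofReal_tsum]
    congr 1
    · norm_num
    · congr 1
      ext n
      have e1 := hpow (n+1) (by positivity)
      have e2 := hpow2 (n+1) (by positivity)
      have e3 := hpow (n+1+1) (by positivity)
      rw [e1, e2, e3]
      rw [show (n:ℝ)+1+1 = n+2 by ring]
      push_cast
      ring
  rw [hz, Complex.ofReal_re]

lemma g_integrable (x : ℝ) (hx : 0 < x) : IntegrableOn (fun t : ℝ => Real.exp (-(x*t)) / √t) (Ioi 0) := by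
  have := integrableOn_rpow_mul_exp_neg_mul_rpow (p := 1) (s := -(1/2)) (b := x) (by norm_num) one_pos hx
  refine this.congr_fun (fun t ht => ?_) measurableSet_Ioi
  have ht' : (0:ℝ) < t := ht
  simp only [Real.rpow_one]
  rw [Real.sqrt_eq_rpow, Real.rpow_neg ht'.le, div_eq_mul_inv, mul_comm]
  ring_nf

lemma g_integral (x : ℝ) (hx : 0 < x) : ∫ t in Ioi (0:ℝ), Real.exp (-(x*t)) / √t = √π * x ^ (-(1/2) : ℝ) := by
  have := Real.integral_rpow_mul_exp_neg_mul_Ioi (a := 1/2) (r := x) (by norm_num) hx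
  rw [Real.Gamma_one_half_eq] at this
  rw [Real.rpow_neg hx.le, mul_comm, ← Real.inv_rpow hx.le, ← one_div, ← this]
  refine setIntegral_congr_fun measurableSet_Ioi (fun t ht => ?_)
  have ht' : (0:ℝ) < t := ht
  try simp only
  rw [show (1/2 - 1 : ℝ) = -(1/2) by norm_num, Real.sqrt_eq_rpow, Real.rpow_neg ht'.le, div_eq_mul_inv, mul_comm]

lemma g_int (x : ℝ) (hx : 0 < x) (a b : ℝ) (ha : 0 ≤ a) (hab : a ≤ b) :
    IntervalIntegrable (fun t : ℝ => Real.exp (-(x*t)) / √t) volume a b := by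
  rw [intervalIntegrable_iff_integrableOn_Ioc_of_le hab]
  exact (g_integrable x hx).mono_set fun t ht => lt_of_le_of_lt ha ht.1

lemma g_anti (x : ℝ) (hx : 0 < x) (s t : ℝ) (hs : 0 < s) (hst : s ≤ t) :
    Real.exp (-(x*t)) / √t ≤ Real.exp (-(x*s)) / √s := by
  have : 0 < √s := Real.sqrt_pos.2 hs
  gcongr

lemma g_lower (x : ℝ) (hx : 0 < x) (n : ℕ) :
    Real.exp (-(x*((n:ℝ)+2))) / √((n:ℝ)+2) ≤ ∫ t in ((n:ℝ)+1)..((n:ℝ)+2), Real.exp (-(x*t)) / √t := by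
  have h := intervalIntegral.integral_mono_on (μ := volume) (a := (n:ℝ)+1) (b := (n:ℝ)+2) (by linarith)
    (f := fun _ => Real.exp (-(x*((n:ℝ)+2))) / √((n:ℝ)+2)) (by simp)
    (g_int x hx _ _ (by positivity) (by linarith))
    (fun t ht => g_anti x hx t _ (by have := ht.1; have : (0:ℝ) ≤ n := by positivity
                                     linarith) ht.2)
  rw [intervalIntegral.integral_const] at h
  convert h using 1
  simp only [smul_eq_mul]; ring

lemma g_upper (x : ℝ) (hx : 0 < x) (n : ℕ) :
    ∫ t in ((n:ℝ)+1)..((n:ℝ)+2), Real.exp (-(x*t)) / √t ≤ Real.exp (-(x*((n:ℝ)+1))) / √((n:ℝ)+1) := by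
  have h := intervalIntegral.integral_mono_on (μ := volume) (a := (n:ℝ)+1) (b := (n:ℝ)+2) (by linarith)
    (g := fun _ => Real.exp (-(x*((n:ℝ)+1))) / √((n:ℝ)+1))
    (g_int x hx _ _ (by positivity) (by linarith)) (by simp)
    (fun t ht => g_anti x hx _ t (by positivity) ht.1)
  rw [intervalIntegral.integral_const] at h
  convert h using 1
  simp only [smul_eq_mul]; ring

lemma g_diff (x : ℝ) (hx : 0 < x) (n : ℕ) :
    Real.exp (-(x*((n:ℝ)+1))) / √((n:ℝ)+1) - Real.exp (-(x*((n:ℝ)+2))) / √((n:ℝ)+2) 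
      ≤ 2 * ((n:ℝ)+1) ^ (-(3/2) : ℝ) := by
  set a : ℝ := (n:ℝ)+1 with ha
  have ha0 : 0 < a := by positivity
  rw [show (n:ℝ)+2 = a + 1 by rw [ha]; ring]
  have hE : Real.exp (-(x*(a+1))) = Real.exp (-(x*a)) * Real.exp (-x) := by rw [← Real.exp_add]; ring_nf
  have h1 : 1 - x ≤ Real.exp (-x) := by have := Real.add_one_le_exp (-x); linarith
  have hE0 := Real.exp_pos (-(x*a))
  have hE1 : Real.exp (-(x*a)) ≤ 1 := Real.exp_le_one_iff.2 (by have := mul_pos hx ha0; linarith)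
  have h2 : x * a * Real.exp (-(x*a)) ≤ 1 := by
    have := Real.add_one_le_exp (x*a)
    rw [Real.exp_neg, ← div_eq_mul_inv, div_le_one (Real.exp_pos _)]; linarith
  have hs : 0 < √a := Real.sqrt_pos.2 ha0
  have hs' : 0 < √(a+1) := Real.sqrt_pos.2 (by linarith)
  have hR : a ^ (-(3/2) : ℝ) = 1 / (√a * a) := by
    rw [show (-(3/2) : ℝ) = -(1/2) - 1 by norm_num, Real.rpow_sub ha0, Real.rpow_one, Real.rpow_neg ha0.le, ← Real.sqrt_eq_rpow]
    field_simp
  rw [hR, hE]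
  have h3 : 1 / √a - 1/(a * √a) ≤ 1 / √(a+1) := by
    have hq : √a * √a = a := Real.mul_self_sqrt ha0.le
    have hq' : √(a+1) * √(a+1) = a+1 := Real.mul_self_sqrt (by linarith)
    have : 1 / √a - 1/(a * √a) = (a - 1) / (a * √a) := by field_simp
    rw [this, div_le_div_iff₀ (by positivity) hs', one_mul]
    by_cases h : a ≤ 1
    · have : (a-1) * √(a+1) ≤ 0 := mul_nonpos_of_nonpos_of_nonneg (by linarith) hs'.le
      have : 0 < a * √a := by positivity
      linarith
    · push Not at h
      have e1 : (a * √a)^2 = a^2 * (√a * √a) := by ring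
      have e2 : ((a - 1) * √(a + 1)) ^ 2 = (a-1)^2 * (√(a + 1) * √(a+1)) := by ring
      apply le_of_sq_le_sq _ (by positivity)
      rw [e1, e2, hq, hq']
      nlinarith
  have h4 : Real.exp (-(x*a)) * Real.exp (-x) ≥ Real.exp (-(x*a)) - 1 / a := by
    have : Real.exp (-(x*a)) * (1 - x) ≤ Real.exp (-(x*a)) * Real.exp (-x) := by gcongr
    have h5 : x * Real.exp (-(x*a)) ≤ 1 / a := by rw [le_div_iff₀ ha0]; linarith
    nlinarith
  have h5 : Real.exp (-(x*a)) * Real.exp (-x) / √(a+1) ≥ (Real.exp (-(x*a)) - 1 / a) / √(a+1) := by gcongr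
  have h6 : Real.exp (-(x*a)) / √(a+1) ≥ Real.exp (-(x*a)) * (1 / √a - 1/(a * √a)) := by
    rw [div_eq_mul_one_div]; gcongr
  have h7 : 1 / a / √(a+1) ≤ 1 / a / √a := by
    gcongr; linarith
  have h8 : Real.exp (-(x*a)) * (1/(a * √a)) ≤ 1 * (1/(a * √a)) := by gcongr
  rw [sub_div] at h5
  have e1 : 1 / a / √a = 1/(a * √a) := by field_simp
  rw [e1] at h7
  rw [mul_sub, ← div_eq_mul_one_div] at h6
  rw [mul_comm (√a)]
  linarith

lemma g_tail (x : ℝ) (hx : 0 < x) : HasSum (fun n : ℕ => ∫ t in ((n:ℝ)+1)..((n:ℝ)+2), Real.exp (-(x*t)) / √t)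
    (∫ t in Ioi (1:ℝ), Real.exp (-(x*t)) / √t) := by
  rw [hasSum_iff_tendsto_nat_of_nonneg]
  · have h := intervalIntegral_tendsto_integral_Ioi (μ := volume) (1:ℝ) ((g_integrable x hx).mono_set (Ioi_subset_Ioi zero_le_one))
      (Filter.tendsto_atTop_add_const_right Filter.atTop (1:ℝ) tendsto_natCast_atTop_atTop)
    refine h.congr fun N => ?_
    have := intervalIntegral.sum_integral_adjacent_intervals (μ := volume) (f := fun t : ℝ => Real.exp (-(x*t)) / √t)
      (a := fun k : ℕ => (k:ℝ)+1) (n := N) (fun k _ => g_int x hx _ _ (by positivity) (by push_cast; linarith))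
    simp only [Nat.cast_zero, zero_add] at this
    rw [← this]
    apply Finset.sum_congr rfl
    intro k _
    push_cast
    rw [show (k:ℝ)+1+1 = k+2 by ring]
  · intro n
    exact le_trans (by positivity) (g_lower x hx n)

lemma summ_32 : Summable fun n : ℕ => 2 * ((n:ℝ)+1) ^ (-(3/2) : ℝ) := by
  apply Summable.mul_left
  have := (summable_nat_add_iff 1).2 (Real.summable_nat_rpow.2 (show (-(3/2) : ℝ) < -1 by norm_num))
  simpa using this

lemma u_bound (x : ℝ) (hx : 0 < x) (n : ℕ) : ‖Real.exp (-(x*((n:ℝ)+1))) / √((n:ℝ)+1) - ∫ t in ((n:ℝ)+1)..((n:ℝ)+2), Real.exp (-(x*t)) / √t‖ ≤ 2 * ((n:ℝ)+1) ^ (-(3/2) : ℝ) := by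
  rw [Real.norm_eq_abs, abs_of_nonneg (by have := g_upper x hx n; linarith)]
  have := g_lower x hx n
  have := g_diff x hx n
  linarith

lemma A_eq (x : ℝ) (hx : 0 < x) : (∑' n : ℕ, Real.exp (-(x*(n+1))) / √((n:ℝ)+1)) - √π * x ^ (-(1/2) : ℝ)
   = (∑' n : ℕ, (Real.exp (-(x*((n:ℝ)+1))) / √((n:ℝ)+1) - ∫ t in ((n:ℝ)+1)..((n:ℝ)+2), Real.exp (-(x*t)) / √t)) 
     - ∫ t in (0:ℝ)..1, Real.exp (-(x*t)) / √t := by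
  have hu := Summable.of_norm_bounded summ_32 (u_bound x hx)
  have ht := g_tail x hx
  have hA : Summable fun n : ℕ => Real.exp (-(x*((n:ℝ)+1))) / √((n:ℝ)+1) := by
    refine (hu.add ht.summable).congr fun n => by ring
  rw [hA.tsum_sub ht.summable, ht.tsum_eq, ← g_integral x hx, 
    ← intervalIntegral.integral_interval_add_Ioi' (a := 0) (b := 1) (g_int x hx 0 1 le_rfl zero_le_one) ((g_integrable x hx).mono_set (Ioi_subset_Ioi zero_le_one))]
  ring

lemma int_lim (a b : ℝ) (ha : 0 ≤ a) (hab : a ≤ b) : 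
    Filter.Tendsto (fun x : ℝ => ∫ t in a..b, Real.exp (-(x*t)) / √t) (nhdsWithin 0 (Ioi 0)) (nhds (2 * (√b - √a))) := by
  have hI : ∫ t in a..b, 1 / √t = 2 * (√b - √a) := by
    have := integral_rpow (a := a) (b := b) (r := -(1/2)) (Or.inl (by norm_num))
    rw [show (-(1/2) + 1 : ℝ) = 1/2 by norm_num, ← Real.sqrt_eq_rpow, ← Real.sqrt_eq_rpow] at this
    rw [show 2 * (√b - √a) = (√b - √a) / (1/2) by ring, ← this]
    apply intervalIntegral.integral_congr
    intro t ht
    rw [uIcc_of_le hab] at ht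
    try simp only
    rw [Real.rpow_neg (ha.trans ht.1), Real.sqrt_eq_rpow, one_div (t ^ _)]
  have hIntg : IntervalIntegrable (fun t : ℝ => 1 / √t) volume a b := by
    have := intervalIntegral.intervalIntegrable_rpow' (a := a) (b := b) (r := -(1/2)) (by norm_num)
    refine this.congr fun t ht => ?_
    rw [uIoc_of_le hab] at ht
    try simp only
    rw [Real.rpow_neg (ha.trans ht.1.le), Real.sqrt_eq_rpow, one_div (t ^ _)]
  rw [← hI]
  apply intervalIntegral.tendsto_integral_filter_of_dominated_convergence (fun t : ℝ => 1 / √t)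
  · refine Filter.Eventually.of_forall fun x => ?_
    apply Measurable.aestronglyMeasurable
    fun_prop
  · filter_upwards [self_mem_nhdsWithin] with x hx
    refine Filter.Eventually.of_forall fun t ht => ?_
    rw [uIoc_of_le hab] at ht
    rw [Real.norm_eq_abs, abs_of_nonneg (by positivity)]
    gcongr
    apply Real.exp_le_one_iff.2
    have := mul_nonneg (le_of_lt hx) (ha.trans ht.1.le)
    linarith
  · exact hIntg
  · refine Filter.Eventually.of_forall fun t ht => ?_
    have : Continuous fun x : ℝ => Real.exp (-(x*t)) / √t := by fun_prop
    have := this.tendsto 0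
    simp only [zero_mul, neg_zero, Real.exp_zero] at this
    exact this.mono_left nhdsWithin_le_nhds

lemma A_lim : Filter.Tendsto (fun x : ℝ => (∑' n : ℕ, Real.exp (-(x*(n+1))) / √((n:ℝ)+1)) - √π * x ^ (-(1/2) : ℝ))
    (nhdsWithin 0 (Ioi 0)) (nhds (riemannZeta (1/2)).re) := by
  have h1 : Filter.Tendsto (fun x : ℝ => ∑' n : ℕ, (Real.exp (-(x*((n:ℝ)+1))) / √((n:ℝ)+1) - ∫ t in ((n:ℝ)+1)..((n:ℝ)+2), Real.exp (-(x*t)) / √t)) (nhdsWithin 0 (Ioi 0)) (nhds (∑' n : ℕ, (1 / √((n:ℝ)+1) - 2 * (√((n:ℝ)+2) - √((n:ℝ)+1))))) := by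
    apply tendsto_tsum_of_dominated_convergence summ_32
    · intro n
      refine Filter.Tendsto.sub ?_ (int_lim _ _ (by positivity) (by linarith))
      have : Continuous fun x : ℝ => Real.exp (-(x*((n:ℝ)+1))) / √((n:ℝ)+1) := by fun_prop
      have := this.tendsto 0
      simp only [zero_mul, neg_zero, Real.exp_zero] at this
      exact this.mono_left nhdsWithin_le_nhds
    · filter_upwards [self_mem_nhdsWithin] with x hx n
      exact u_bound x hx n
  have h2 := h1.sub (int_lim 0 1 le_rfl zero_le_one)
  have e : (∑' n : ℕ, (1 / √((n:ℝ)+1) - 2 * (√((n:ℝ)+2) - √((n:ℝ)+1)))) - 2 * (√1 - √0) = (riemannZeta (1/2)).re := by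
    rw [zeta_const]; simp; ring
  rw [e] at h2
  refine h2.congr' ?_
  filter_upwards [self_mem_nhdsWithin] with x hx
  exact (A_eq x hx).symm

lemma main_x (x : ℝ) (hx : 0 < x) (hx' : x < 2 * π) :
    (∑' n : ℕ, Real.exp (-(x*(n+1))) / √((n:ℝ)+1)) = √π * x ^ (-(1/2) : ℝ) +
      ∑' r:ℕ, (riemannZeta (1/2 - (r:ℂ))).re * (-x)^r / r.factorial := by
  set A : ℝ → ℝ := fun x => ∑' n : ℕ, Real.exp (-(x*(n+1))) / √((n:ℝ)+1) with hA
  set R : ℝ → ℝ := fun x => ∑' r:ℕ, (riemannZeta (1/2 - (r:ℂ))).re * (-x)^r / r.factorial with hR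
  have hpi := Real.pi_pos
  have hd : ∀ y ∈ Ioo 0 (2*π), HasDerivAt (fun y => A y - √π * y ^ (-(1/2) : ℝ) - R y) 0 y := by
    intro y hy
    have h1 := A_deriv y hy.1
    have h2 := R_deriv y (by rw [abs_of_pos hy.1]; exact hy.2)
    have h3 := (Real.hasDerivAt_rpow_const (x := y) (p := -(1/2)) (Or.inl hy.1.ne')).const_mul (√π)
    convert! (h1.sub h3).sub h2 using 1
    rw [lerch_deriv_id y hy.1 hy.2, show (3/2 : ℝ) = 1/2 + 1 by norm_num, Real.Gamma_add_one (by norm_num),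
      Real.Gamma_one_half_eq, show (-(1/2) - 1 : ℝ) = -(1/2 + 1) by norm_num]
    ring
  have hR0 : R 0 = (riemannZeta (1/2)).re := by
    simp only [hR, neg_zero]
    rw [tsum_eq_single 0]
    · simp
    · intro r hr; simp [hr]
  have hRl : Filter.Tendsto R (nhdsWithin 0 (Ioi 0)) (nhds (riemannZeta (1/2)).re) := by
    rw [← hR0]
    exact (R_deriv 0 (by simp [hpi])).continuousAt.tendsto.mono_left nhdsWithin_le_nhds
  have hl := A_lim.sub hRl
  rw [sub_self] at hl
  have hc : ∀ y ∈ Ioo 0 (2*π), A y - √π * y ^ (-(1/2) : ℝ) - R y = A x - √π * x ^ (-(1/2) : ℝ) - R x := by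
    intro y hy
    refine isOpen_Ioo.is_const_of_deriv_eq_zero (f := fun y => A y - √π * y ^ (-(1/2) : ℝ) - R y) isPreconnected_Ioo (fun z hz => (hd z hz).differentiableAt.differentiableWithinAt) (fun z hz => (hd z hz).deriv) hy ⟨hx, hx'⟩
  have hl2 : Filter.Tendsto (fun y => A y - √π * y ^ (-(1/2) : ℝ) - R y) (nhdsWithin 0 (Ioi 0)) (nhds (A x - √π * x ^ (-(1/2) : ℝ) - R x)) := by
    refine tendsto_const_nhds.congr' ?_
    filter_upwards [Ioo_mem_nhdsGT (show (0:ℝ) < 2 * π by positivity)] with y hy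
    exact (hc y hy).symm
  have := tendsto_nhds_unique hl2 hl
  linarith

/-- For `0 < β < 2√π`,
`∑_{n≥1} e^{-nβ²/2}/√(2πn) = 1/β + (1/√(2π))·∑_{r≥0} ζ(1/2 − r)·(−β²/2)^r / r!`. -/
theorem lerch_expansion_half (β : ℝ) (hβ : 0 < β) (hβ' : β < 2 * Real.sqrt π) :
    (∑' n : ℕ, Real.exp (-((n : ℝ) + 1) * β ^ 2 / 2) / Real.sqrt (2 * π * ((n : ℝ) + 1)))
      = 1 / β + (1 / Real.sqrt (2 * π)) *
          ∑' r : ℕ, (riemannZeta (1 / 2 - (r : ℂ))).re * (-β ^ 2 / 2) ^ r / r.factorial := by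
  have hpi := Real.pi_pos
  have hx' : β ^ 2 / 2 < 2 * π := by
    have := Real.sq_sqrt hpi.le
    nlinarith [Real.sqrt_nonneg π]
  have h := main_x (β^2/2) (by positivity) hx'
  have e1 : ∀ n : ℕ, Real.exp (-((n : ℝ) + 1) * β ^ 2 / 2) / Real.sqrt (2 * π * ((n : ℝ) + 1)) = 
      (1 / √(2*π)) * (Real.exp (-(β^2/2*(n+1))) / √((n:ℝ)+1)) := by
    intro n
    rw [Real.sqrt_mul (by positivity) ((n:ℝ)+1), show -((n : ℝ) + 1) * β ^ 2 / 2 = -(β^2/2*(n+1)) by ring]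
    field_simp
  simp_rw [e1]
  rw [tsum_mul_left, h, mul_add, show -β^2/2 = -(β^2/2) by ring]
  congr 1
  rw [Real.rpow_neg (by positivity), ← Real.sqrt_eq_rpow, Real.sqrt_div (by positivity), Real.sqrt_sq hβ.le,
    Real.sqrt_mul (by norm_num)]
  have : 0 < √π := Real.sqrt_pos.2 hpi
  have : 0 < √2 := by positivity
  field_simp
end

section
/- For β with 0 < β < 2√π, the identity (1/√(2π))·∑_{n=1}^∞ √n·e^{-nβ²/2} = 1/β³ + (1/√(2π))·∑_{r=0}^∞ ζ(−1/2 − r)·(−β²/2)^r / r! holds. -/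
open Real MeasureTheory Set

lemma laplace_sqrt (z : ℂ) (hz : 0 < z.re) :
    ∫ t in Ioi (0:ℝ), (√t : ℂ) * Complex.exp (-(z * t)) = Complex.Gamma (3/2) * z ^ (-(3/2) : ℂ) := by
  have hmeas : ∀ w : ℂ, AEStronglyMeasurable (fun t : ℝ => (√t : ℂ) * Complex.exp (-(w * t)))
      (volume.restrict (Ioi 0)) := fun w => by
    apply Continuous.aestronglyMeasurable
    fun_prop
  have hint : ∀ w : ℂ, 0 < w.re →
      Integrable (fun t : ℝ => (√t : ℂ) * Complex.exp (-(w * t))) (volume.restrict (Ioi 0)) := by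
    intro w hw
    have h := integrableOn_rpow_mul_exp_neg_mul_rpow (p := 1) (s := 1/2) (b := w.re)
      (by norm_num) (by norm_num) hw
    refine Integrable.mono' h (hmeas w) ?_
    filter_upwards [ae_restrict_mem measurableSet_Ioi] with t ht
    rw [norm_mul, Complex.norm_exp, Complex.norm_real, Real.norm_of_nonneg (sqrt_nonneg _),
      Real.sqrt_eq_rpow]
    simp
  have hdiff : DifferentiableOn ℂ (fun w : ℂ => ∫ t in Ioi (0:ℝ), (√t : ℂ) * Complex.exp (-(w * t)))
      {w : ℂ | 0 < w.re} := by
    intro w hw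
    have hw : 0 < w.re := hw
    apply DifferentiableAt.differentiableWithinAt
    have hs : {v : ℂ | w.re / 2 < v.re} ∈ nhds w :=
      (isOpen_lt continuous_const Complex.continuous_re).mem_nhds (by
        change w.re / 2 < w.re; linarith)
    refine (hasDerivAt_integral_of_dominated_loc_of_deriv_le
      (F' := fun v t => (√t : ℂ) * (Complex.exp (-(v * t)) * (-(1 * (t : ℂ)))))
      (bound := fun t => t ^ (3/2 : ℝ) * Real.exp (-(w.re/2) * t ^ (1 : ℝ))) hs
      (Filter.Eventually.of_forall hmeas) (hint w hw) ?_ ?_ ?_ ?_).2.differentiableAt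
    · apply Continuous.aestronglyMeasurable
      fun_prop
    · filter_upwards [ae_restrict_mem measurableSet_Ioi] with t ht v hv
      have ht : 0 < t := ht
      have hv : w.re / 2 < v.re := hv
      rw [norm_mul, norm_mul, Complex.norm_exp, Complex.norm_real,
        Real.norm_of_nonneg (sqrt_nonneg _), Real.sqrt_eq_rpow, norm_neg, one_mul,
        Complex.norm_real, Real.norm_of_nonneg ht.le, rpow_one]
      have : t ^ (3/2 : ℝ) = t ^ (1/2 : ℝ) * t := by
        rw [← rpow_add_one ht.ne']; norm_num
      rw [this, mul_assoc, mul_comm t]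
      gcongr
      simp
      nlinarith
    · exact integrableOn_rpow_mul_exp_neg_mul_rpow (by norm_num) (by norm_num) (by linarith)
    · refine Filter.Eventually.of_forall fun t v _ => ?_
      exact ((((hasDerivAt_id v).mul_const (t:ℂ)).neg).cexp).const_mul _
  have hopen : IsOpen {w : ℂ | 0 < w.re} := isOpen_lt continuous_const Complex.continuous_re
  have hA := hdiff.analyticOnNhd hopen
  have hB : AnalyticOnNhd ℂ (fun w : ℂ => Complex.Gamma (3/2) * w ^ (-(3/2) : ℂ)) {w : ℂ | 0 < w.re} := by
    apply DifferentiableOn.analyticOnNhd _ hopen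
    intro w hw
    apply DifferentiableAt.differentiableWithinAt
    apply DifferentiableAt.const_mul
    apply DifferentiableAt.cpow_const differentiableAt_id
    exact Or.inl hw
  have hconn : IsPreconnected {w : ℂ | 0 < w.re} := (convex_halfSpace_re_gt 0).isPreconnected
  have hreal : ∀ r : ℝ, 0 < r → ∫ t in Ioi (0:ℝ), (√t : ℂ) * Complex.exp (-((r:ℂ) * t)) =
      Complex.Gamma (3/2) * (r:ℂ) ^ (-(3/2) : ℂ) := by
    intro r hr
    have h := Complex.integral_cpow_mul_exp_neg_mul_Ioi (a := 3/2) (r := r) (by norm_num) hr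
    rw [one_div, Complex.inv_cpow _ _ (by rw [Complex.arg_ofReal_of_nonneg hr.le]; exact pi_pos.ne),
      ← Complex.cpow_neg, mul_comm] at h
    rw [← h]
    refine setIntegral_congr_fun measurableSet_Ioi fun t ht => ?_
    have ht : 0 < t := ht
    rw [Real.sqrt_eq_rpow, Complex.ofReal_cpow ht.le]
    norm_num
  refine hA.eqOn_of_preconnected_of_frequently_eq hB hconn (z₀ := 1) (by simp) ?_ hz
  have hmap : Filter.Tendsto (fun r : ℝ => (r : ℂ)) (nhdsWithin 1 {1}ᶜ) (nhdsWithin 1 {1}ᶜ) := by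
    refine tendsto_nhdsWithin_iff.2 ⟨?_, ?_⟩
    · exact (Complex.continuous_ofReal.tendsto' 1 1 (by simp)).mono_left nhdsWithin_le_nhds
    · filter_upwards [self_mem_nhdsWithin] with r hr
      simpa using hr
  refine hmap.frequently (Filter.Eventually.frequently ?_)
  filter_upwards [nhdsWithin_le_nhds (lt_mem_nhds (zero_lt_one' ℝ))] with r hr
  exact hreal r hr

lemma fourier_sqrt_exp (a : ℝ) (ha : 0 < a) (ξ : ℝ) :
    FourierTransform.fourier (fun x : ℝ => ((√x * Real.exp (-(a * x)) : ℝ) : ℂ)) ξ =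
      Complex.Gamma (3/2) * ((a : ℂ) + 2 * π * ξ * Complex.I) ^ (-(3/2) : ℂ) := by
  rw [Real.fourier_real_eq_integral_exp_smul, ← laplace_sqrt _ (by simpa using ha),
    ← integral_indicator measurableSet_Ioi]
  congr 1
  ext t
  by_cases ht : 0 < t
  · rw [indicator_of_mem (by exact ht)]
    push_cast
    rw [smul_eq_mul, mul_left_comm, ← Complex.exp_add]
    congr 2
    ring
  · rw [indicator_of_notMem (by exact ht), Real.sqrt_eq_zero_of_nonpos (not_lt.1 ht)]
    simp

lemma poisson_sqrt (a : ℝ) (ha : 0 < a)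
    (hs : Summable fun n : ℤ => Complex.Gamma (3/2) * ((a : ℂ) + 2 * π * n * Complex.I) ^ (-(3/2) : ℂ)) :
    ∑' n : ℤ, ((√n * Real.exp (-(a * n)) : ℝ) : ℂ) =
    ∑' n : ℤ, Complex.Gamma (3/2) * ((a : ℂ) + 2 * π * n * Complex.I) ^ (-(3/2) : ℂ) := by
  have hF := fourier_sqrt_exp a ha
  have h := Real.tsum_eq_tsum_fourier_of_rpow_decay_of_summable
    (f := fun x : ℝ => ((√x * Real.exp (-(a * x)) : ℝ) : ℂ)) (by fun_prop) (b := 2) (by norm_num)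
    ?_ ?_ 0
  · simp only [hF, zero_add] at h
    rw [h]
    simp
  · rw [cocompact_eq_atBot_atTop, Asymptotics.isBigO_sup]
    constructor
    · refine Filter.EventuallyEq.trans_isBigO (f₂ := fun _ => (0:ℂ)) ?_ (Asymptotics.isBigO_zero _ _)
      filter_upwards [Filter.eventually_le_atBot 0] with x hx
      rw [Real.sqrt_eq_zero_of_nonpos hx]; simp
    · have h1 := (isLittleO_exp_neg_mul_rpow_atTop ha (-(5/2))).isBigO
      have h2 := (Asymptotics.isBigO_refl (fun x : ℝ => √x) Filter.atTop).mul h1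
      rw [← Asymptotics.isBigO_norm_left]
      refine (h2.norm_left.congr' ?_ ?_)
      · filter_upwards with x
        rw [Complex.norm_real, neg_mul]
      · filter_upwards [Filter.eventually_gt_atTop 0] with x hx
        rw [Real.sqrt_eq_rpow, ← rpow_add hx, abs_of_pos hx]; norm_num
  · simp only [hF]
    simpa using hs


lemma binom_hasSum (y : ℂ) (hy : ‖y‖ < 1) :
    HasSum (fun r : ℕ => Ring.choose (-(3/2) : ℂ) r * y ^ r) ((1 + y) ^ (-(3/2) : ℂ)) := by
  have h := (Complex.one_add_cpow_hasFPowerSeriesOnBall_zero (a := -(3/2))).hasSum (y := y)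
    (by
      rw [Metric.mem_eball, edist_zero_right, ← ofReal_norm, ENNReal.ofReal_lt_one]; exact hy)
  simp only [zero_add, binomialSeries_apply, List.ofFn_const, List.prod_replicate, smul_eq_mul] at h
  exact h

lemma binom_summable_norm (x : ℝ) (hx : 0 ≤ x) (hx1 : x < 1) :
    Summable (fun r : ℕ => ‖Ring.choose (-(3/2) : ℂ) r‖ * x ^ r) := by
  have h := (binom_hasSum (x:ℂ) (by simpa [abs_of_nonneg hx] using hx1)).summable.norm
  simpa [abs_of_nonneg hx] using h

lemma choose_gamma (r : ℕ) : Complex.Gamma (3/2 + r) * (-1) ^ r / r.factorial =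
    Complex.Gamma (3/2) * Ring.choose (-(3/2) : ℂ) r := by
  induction r with
  | zero => simp
  | succ r ih =>
    have h := Ring.choose_smul_choose (-(3/2) : ℂ) (n := r + 1) (k := r) (by omega)
    rw [Nat.choose_succ_self_right, nsmul_eq_mul, Nat.add_sub_cancel_left, Ring.choose_one_right] at h
    have hr : (r:ℂ) + 1 ≠ 0 := Nat.cast_add_one_ne_zero r
    have hg : Complex.Gamma (3/2 + (r + 1 : ℕ)) = (3/2 + r) * Complex.Gamma (3/2 + r) := by
      rw [← Complex.Gamma_add_one]
      · push_cast; congr 1; ring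
      · intro h0
        have := congrArg Complex.re h0
        simp at this
        have h1 : (0:ℝ) ≤ r := Nat.cast_nonneg r
        linarith
    have hf : (r.factorial : ℂ) ≠ 0 := by exact_mod_cast r.factorial_ne_zero
    have hc : Ring.choose (-(3/2) : ℂ) (r+1) = Ring.choose (-(3/2) : ℂ) r * (-(3/2) - r) / (r + 1) := by
      rw [eq_div_iff hr, ← h]; push_cast; ring
    rw [hg, hc, Nat.factorial_succ]
    rw [div_eq_iff hf] at ih
    push_cast
    rw [div_eq_iff (mul_ne_zero hr hf), pow_succ]
    have : Complex.Gamma (3 / 2) * (Ring.choose (-(3/2) : ℂ) r * (-(3/2) - r) / (r + 1)) * ((r + 1) * r.factorial)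
        = (Complex.Gamma (3/2) * Ring.choose (-(3/2) : ℂ) r * r.factorial) * (-(3/2) - r) := by
      field_simp
    rw [this, ← ih]
    ring

lemma double_sum (y : ℂ) (hy : ‖y‖ < 1) : ∃ A : ℂ,
    HasSum (fun m : ℕ => ((m:ℂ) + 1) ^ (-(3/2) : ℂ) * (1 + y / (m + 1)) ^ (-(3/2) : ℂ)) A ∧
    HasSum (fun r : ℕ => Ring.choose (-(3/2) : ℂ) r * y ^ r * riemannZeta (3/2 + r)) A := by
  obtain ⟨F, hFdef⟩ : ∃ F : ℕ × ℕ → ℂ, F = fun p => ((p.1:ℂ) + 1) ^ (-(3/2) : ℂ) *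
    (Ring.choose (-(3/2) : ℂ) p.2 * (y / (p.1 + 1)) ^ p.2) := ⟨_, rfl⟩
  have hn : ∀ m : ℕ, ‖(m:ℂ) + 1‖ = (m:ℝ) + 1 := fun m => by
    rw [← Nat.cast_add_one, Complex.norm_natCast]; push_cast; rfl
  have hsumm : Summable (fun m : ℕ => ((m:ℝ) + 1) ^ (-(3/2) : ℝ)) := by
    have := (summable_nat_add_iff 1).2 (Real.summable_nat_rpow.2 (by norm_num : (-(3/2):ℝ) < -1))
    simpa using this
  have hF : Summable F := by
    refine Summable.of_norm_bounded
      (g := fun p : ℕ × ℕ => ((p.1:ℝ) + 1) ^ (-(3/2) : ℝ) *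
        (‖Ring.choose (-(3/2) : ℂ) p.2‖ * ‖y‖ ^ p.2))
      (hsumm.mul_of_nonneg (binom_summable_norm _ (norm_nonneg y) hy)
        (fun m => by positivity) (fun m => by positivity)) ?_
    rintro ⟨m, r⟩
    simp only [hFdef, norm_mul, norm_pow, norm_div, hn]
    have : ‖((m:ℂ) + 1) ^ (-(3/2) : ℂ)‖ = ((m:ℝ) + 1) ^ (-(3/2) : ℝ) := by
      have := Complex.norm_cpow_eq_rpow_re_of_pos (x := (m:ℝ) + 1) (by positivity) (-(3/2) : ℂ)
      simpa using this
    rw [this]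
    gcongr
    apply div_le_self (norm_nonneg _)
    simp
  refine ⟨∑' p, F p, ?_, ?_⟩
  · refine hF.hasSum.prod_fiberwise fun m => ?_
    simp only [hFdef]
    apply HasSum.mul_left
    apply binom_hasSum
    rw [norm_div, hn]
    refine lt_of_le_of_lt (div_le_self (norm_nonneg _) (by simp)) hy
  · have hF' : HasSum (fun p : ℕ × ℕ => F p.swap) (∑' p, F p) :=
      (Equiv.prodComm ℕ ℕ).hasSum_iff.2 hF.hasSum
    refine hF'.prod_fiberwise fun r => ?_
    have hre : 1 < (3/2 + r : ℂ).re := by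
      have : (0:ℝ) ≤ r := Nat.cast_nonneg r
      have h' : (3/2 + r : ℂ).re = 3/2 + r := by simp
      rw [h']; linarith
    have h1 : Summable (fun m : ℕ => 1 / ((m:ℂ) + 1) ^ (3/2 + r : ℂ)) := by
      have := (summable_nat_add_iff 1).2 (Complex.summable_one_div_nat_cpow.2 hre)
      simpa using this
    have h2 : HasSum (fun m : ℕ => 1 / ((m:ℂ) + 1) ^ (3/2 + r : ℂ)) (riemannZeta (3/2 + r)) := by
      rw [zeta_eq_tsum_one_div_nat_add_one_cpow hre]
      exact h1.hasSum
    refine (h2.mul_left (Ring.choose (-(3/2) : ℂ) r * y ^ r)).congr_fun ?_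
    intro m
    have hm : (m:ℂ) + 1 ≠ 0 := Nat.cast_add_one_ne_zero m
    simp only [hFdef, Prod.swap]
    rw [Complex.cpow_add _ _ hm, Complex.cpow_neg, Complex.cpow_natCast, div_pow]
    field_simp


lemma mul_cpow_of_arg {x y : ℂ} (hx : x ≠ 0) (hy : y ≠ 0) (h : x.arg + y.arg ∈ Ioc (-π) π) (s : ℂ) :
    (x * y) ^ s = x ^ s * y ^ s := by
  rw [Complex.cpow_def_of_ne_zero hx, Complex.cpow_def_of_ne_zero hy,
    Complex.cpow_def_of_ne_zero (mul_ne_zero hx hy), Complex.log_mul hx hy h, add_mul, Complex.exp_add]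

lemma pos_mul_cpow {x : ℝ} {y : ℂ} (hx : 0 < x) (hy : y ≠ 0) (s : ℂ) :
    ((x:ℂ) * y) ^ s = (x:ℂ) ^ s * y ^ s := by
  apply mul_cpow_of_arg (by exact_mod_cast hx.ne') hy
  rw [Complex.arg_ofReal_of_nonneg hx.le, zero_add]
  exact Complex.arg_mem_Ioc y

lemma cpow_factor (a m : ℝ) (hm : 0 < m) (e : ℝ) (he : e = 1 ∨ e = -1) :
    ((a : ℂ) + 2 * π * (e * m) * Complex.I) ^ (-(3/2) : ℂ) =
      (2 * π : ℂ) ^ (-(3/2) : ℂ) * (m : ℂ) ^ (-(3/2) : ℂ) * Complex.exp (-(e * (3 * π / 4) * Complex.I)) *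
      (1 + (-e * Complex.I * (a / (2 * π))) / m) ^ (-(3/2) : ℂ) := by
  have hpi := pi_pos
  have hpi' : (π : ℂ) ≠ 0 := by exact_mod_cast pi_ne_zero
  have hm' : (m : ℂ) ≠ 0 := by exact_mod_cast hm.ne'
  have hee : (e : ℂ) * e = 1 := by
    rcases he with rfl | rfl <;> norm_num
  have he0 : (e : ℂ) ≠ 0 := by
    rcases he with rfl | rfl <;> norm_num
  obtain ⟨v, hv⟩ : ∃ v : ℂ, v = 1 + (-e * Complex.I * (a / (2 * π))) / m := ⟨_, rfl⟩
  have hvre : v.re = 1 := by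
    have : v = 1 + ((-(e * (a / (2 * π)) / m) : ℝ) : ℂ) * Complex.I := by
      rw [hv]; push_cast; ring
    rw [this, Complex.add_re, Complex.re_ofReal_mul]; simp
  have hv0 : v ≠ 0 := by rintro rfl; simp at hvre
  have harg : |v.arg| < π / 2 := Complex.abs_arg_lt_pi_div_two_iff.2 (Or.inl (by rw [hvre]; norm_num))
  rw [abs_lt] at harg
  have hfac : (a : ℂ) + 2 * π * (e * m) * Complex.I = ((2 * π : ℝ) : ℂ) * ((m : ℂ) * ((e * Complex.I) * v)) := by
    rw [hv]
    push_cast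
    field_simp
    linear_combination ((a:ℂ) * e ^ 2) * Complex.I_sq - (a:ℂ) * hee
  have hlogI : Complex.log (e * Complex.I) = e * (π / 2 * Complex.I) := by
    rcases he with rfl | rfl
    · simp [Complex.log_I]
    · simp [Complex.log_neg_I]
  have hargI : (e * Complex.I : ℂ).arg = e * (π / 2) := by
    rw [← Complex.log_im, hlogI]; simp
  have hI0 : (e * Complex.I : ℂ) ≠ 0 := mul_ne_zero he0 Complex.I_ne_zero
  have h3 : ((e * Complex.I : ℂ) * v) ^ (-(3/2) : ℂ) = (e * Complex.I : ℂ) ^ (-(3/2) : ℂ) * v ^ (-(3/2) : ℂ) := by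
    apply mul_cpow_of_arg hI0 hv0
    rw [hargI]
    rcases he with rfl | rfl <;> constructor <;> linarith
  have h4 : (e * Complex.I : ℂ) ^ (-(3/2) : ℂ) = Complex.exp (-(e * (3 * π / 4) * Complex.I)) := by
    rw [Complex.cpow_def_of_ne_zero hI0, hlogI]
    congr 1; ring
  rw [hfac, ← hv, pos_mul_cpow (by positivity) (mul_ne_zero hm' (mul_ne_zero hI0 hv0)),
    pos_mul_cpow hm (mul_ne_zero hI0 hv0), h3, h4]
  push_cast
  ring

lemma zeta_term (a : ℝ) (r : ℕ) :
    Complex.Gamma (3/2) * (2 * π : ℂ) ^ (-(3/2) : ℂ) * Complex.exp (-((1:ℝ) * (3 * π / 4) * Complex.I)) *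
      (Ring.choose (-(3/2) : ℂ) r * (-(1:ℝ) * Complex.I * (a / (2 * π))) ^ r * riemannZeta (3/2 + r)) +
    Complex.Gamma (3/2) * (2 * π : ℂ) ^ (-(3/2) : ℂ) * Complex.exp (-((-1:ℝ) * (3 * π / 4) * Complex.I)) *
      (Ring.choose (-(3/2) : ℂ) r * (-(-1:ℝ) * Complex.I * (a / (2 * π))) ^ r * riemannZeta (3/2 + r)) =
    riemannZeta (-1/2 - r) * (-(a:ℂ)) ^ r / r.factorial := by
  have hpi' : (π : ℂ) ≠ 0 := by exact_mod_cast pi_ne_zero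
  have hr : (0:ℝ) ≤ r := Nat.cast_nonneg r
  have hre : (3/2 + r : ℂ).re = 3/2 + r := by simp
  have hz := riemannZeta_one_sub (s := 3/2 + r)
    (by
      intro n h
      have h1 := congrArg Complex.re h
      have hn : (0:ℝ) ≤ n := Nat.cast_nonneg n
      rw [hre, Complex.neg_re, Complex.natCast_re] at h1
      linarith)
    (by
      intro h
      have h1 := congrArg Complex.re h
      rw [hre, Complex.one_re] at h1
      linarith)
  have h1 : (1 - (3/2 + r) : ℂ) = -1/2 - r := by ring
  have hf : (r.factorial : ℂ) ≠ 0 := by exact_mod_cast r.factorial_ne_zero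
  have hc := choose_gamma r
  rw [h1] at hz
  have h2 : (2 * π : ℂ) ^ (-(3/2 + r) : ℂ) = (2 * π : ℂ) ^ (-(3/2) : ℂ) / (2 * π) ^ r := by
    rw [neg_add, Complex.cpow_add _ _ (mul_ne_zero two_ne_zero hpi'), Complex.cpow_neg _ (r:ℂ),
      Complex.cpow_natCast]
    rfl
  have hI : Complex.exp (π / 2 * Complex.I) = Complex.I := Complex.exp_pi_div_two_mul_I
  have h3 : 2 * Complex.cos (π * (3/2 + r) / 2) =
      Complex.exp (-((-1:ℝ) * (3 * π / 4) * Complex.I)) * Complex.I ^ r +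
      Complex.exp (-((1:ℝ) * (3 * π / 4) * Complex.I)) * (-Complex.I) ^ r := by
    have hI' : Complex.exp (-(π / 2 * Complex.I)) = -Complex.I := by
      rw [Complex.exp_neg, hI, Complex.inv_I]
    have e1 : Complex.I ^ r = Complex.exp (r * (π / 2 * Complex.I)) := by
      rw [Complex.exp_nat_mul, hI]
    have e2 : (-Complex.I) ^ r = Complex.exp (r * -(π / 2 * Complex.I)) := by
      rw [Complex.exp_nat_mul, hI']
    rw [Complex.two_cos, e1, e2, ← Complex.exp_add, ← Complex.exp_add]
    push_cast
    congr 2 <;> ring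
  have h4 : riemannZeta (-1/2 - r) * (-(a:ℂ)) ^ r / r.factorial =
      (2 * π : ℂ) ^ (-(3/2) : ℂ) / (2 * π) ^ r * (Complex.Gamma (3/2 + r) * (-1) ^ r / r.factorial) *
      (2 * Complex.cos (π * (3/2 + r) / 2)) * riemannZeta (3/2 + r) * (a:ℂ) ^ r := by
    rw [hz, h2, neg_pow (a:ℂ)]
    ring
  rw [h4, hc, h3]
  simp only [mul_pow, div_pow]
  push_cast
  rw [neg_neg, one_pow, neg_pow Complex.I]
  ring

lemma main_complex (a : ℝ) (ha : 0 < a) (ha' : a < 2 * π) :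
    HasSum (fun r : ℕ => riemannZeta (-1/2 - r) * (-(a:ℂ)) ^ r / r.factorial)
      ((∑' n : ℕ, ((√((n:ℝ)+1) * Real.exp (-(a * ((n:ℝ)+1))) : ℝ) : ℂ)) -
        Complex.Gamma (3/2) * (a:ℂ) ^ (-(3/2) : ℂ)) := by
  have hpi := pi_pos
  have hy : ∀ e : ℝ, (e = 1 ∨ e = -1) → ‖(-e * Complex.I * (a / (2 * π)) : ℂ)‖ < 1 := by
    intro e he
    have h1 : ‖(-e * Complex.I * (a / (2 * π)) : ℂ)‖ = a / (2 * π) := by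
      have : (-e * Complex.I * (a / (2 * π)) : ℂ) = ((-e : ℝ) : ℂ) * Complex.I * ((a / (2 * π) : ℝ) : ℂ) := by
        push_cast; ring
      rw [this, norm_mul, norm_mul, Complex.norm_I, Complex.norm_real, Complex.norm_real,
        Real.norm_of_nonneg (by positivity : 0 ≤ a / (2 * π))]
      rcases he with rfl | rfl <;> simp
    rw [h1, div_lt_one (by positivity)]
    exact ha'
  obtain ⟨A, hA1, hA2⟩ := double_sum _ (hy 1 (Or.inl rfl))
  obtain ⟨B, hB1, hB2⟩ := double_sum _ (hy (-1) (Or.inr rfl))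
  have key : ∀ e : ℝ, (e = 1 ∨ e = -1) → ∀ A : ℂ,
      HasSum (fun m : ℕ => ((m:ℂ) + 1) ^ (-(3/2) : ℂ) *
        (1 + (-e * Complex.I * (a / (2 * π))) / (m + 1)) ^ (-(3/2) : ℂ)) A →
      HasSum (fun m : ℕ => Complex.Gamma (3/2) *
        ((a : ℂ) + 2 * π * (e * ((m:ℂ) + 1)) * Complex.I) ^ (-(3/2) : ℂ))
      (Complex.Gamma (3/2) * (2 * π : ℂ) ^ (-(3/2) : ℂ) *
        Complex.exp (-(e * (3 * π / 4) * Complex.I)) * A) := by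
    intro e he A hA
    refine (hA.mul_left _).congr_fun fun m => ?_
    have := cpow_factor a ((m:ℝ) + 1) (by positivity) e he
    push_cast at this
    rw [this]
    ring
  have kA := key 1 (Or.inl rfl) A hA1
  have kB := key (-1) (Or.inr rfl) B hB1
  have hZ := HasSum.of_add_one_of_neg_add_one
    (f := fun n : ℤ => Complex.Gamma (3/2) * ((a : ℂ) + 2 * π * n * Complex.I) ^ (-(3/2) : ℂ))
    (by simpa using kA) (kB.congr_fun fun m => by push_cast; congr 4; ring)
  have hP := poisson_sqrt a ha hZ.summable
  rw [hZ.tsum_eq] at hP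
  have hL : ∑' n : ℤ, ((√n * Real.exp (-(a * n)) : ℝ) : ℂ) =
      ∑' n : ℕ, ((√((n:ℝ)+1) * Real.exp (-(a * ((n:ℝ)+1))) : ℝ) : ℂ) := by
    have hinj : Function.Injective (fun n : ℕ => (n : ℤ) + 1) := fun x y h => by simpa using h
    rw [← hinj.tsum_eq]
    · simp
    · intro n hn
      by_contra hc
      apply hn
      have hn0 : n ≤ 0 := by
        by_contra h0
        exact hc ⟨(n - 1).toNat, by simp only; omega⟩
      have : √(n:ℝ) = 0 := Real.sqrt_eq_zero_of_nonpos (by exact_mod_cast hn0)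
      simp [this]
  rw [hL] at hP
  rw [hP]
  have hS := (hA2.mul_left (Complex.Gamma (3/2) * (2 * π : ℂ) ^ (-(3/2) : ℂ) *
        Complex.exp (-((1:ℝ) * (3 * π / 4) * Complex.I)))).add
    (hB2.mul_left (Complex.Gamma (3/2) * (2 * π : ℂ) ^ (-(3/2) : ℂ) *
        Complex.exp (-((-1:ℝ) * (3 * π / 4) * Complex.I))))
  have hS' := hS.congr_fun fun r => (zeta_term a r).symm
  refine (congrArg (HasSum _) ?_).mpr hS'
  rw [Int.cast_zero, mul_zero, zero_mul, add_zero, Complex.ofReal_one, one_mul]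
  ring

/-- For `0 < β < 2√π`,
`(1/√(2π))·∑_{n≥1} √n·e^{-nβ²/2} = 1/β³ + (1/√(2π))·∑_{r≥0} ζ(−1/2 − r)·(−β²/2)^r / r!`. -/
theorem lerch_expansion_neg_half (β : ℝ) (hβ : 0 < β) (hβ' : β < 2 * Real.sqrt π) :
    (1 / Real.sqrt (2 * π)) *
        (∑' n : ℕ, Real.sqrt ((n : ℝ) + 1) * Real.exp (-((n : ℝ) + 1) * β ^ 2 / 2))
      = 1 / β ^ 3 + (1 / Real.sqrt (2 * π)) *
          ∑' r : ℕ, (riemannZeta (-1 / 2 - (r : ℂ))).re * (-β ^ 2 / 2) ^ r / r.factorial := by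
  have hpi := pi_pos
  have ha : 0 < β ^ 2 / 2 := by positivity
  have ha' : β ^ 2 / 2 < 2 * π := by
    have h := Real.sq_sqrt pi_pos.le
    have h0 := Real.sqrt_nonneg π
    nlinarith
  have h := Complex.hasSum_re (main_complex _ ha ha')
  have hG : Complex.Gamma (3/2) * ((β ^ 2 / 2 : ℝ) : ℂ) ^ (-(3/2) : ℂ) =
      ((√(2 * π) / β ^ 3 : ℝ) : ℂ) := by
    have h1 : Complex.Gamma (3/2) = ((√π / 2 : ℝ) : ℂ) := by
      have h2 : Real.Gamma (3/2) = √π / 2 := by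
        have := Real.Gamma_add_one (s := 1/2) (by norm_num)
        rw [Real.Gamma_one_half_eq] at this
        rw [show (3/2:ℝ) = 1/2 + 1 by norm_num, this]; ring
      rw [← h2, ← Complex.Gamma_ofReal]; norm_num
    have h3 : ((β ^ 2 / 2 : ℝ) : ℂ) ^ (-(3/2) : ℂ) = (((β ^ 2 / 2) ^ (-(3/2) : ℝ) : ℝ) : ℂ) := by
      rw [Complex.ofReal_cpow ha.le]; norm_num
    have h4 : (β ^ 2 / 2) ^ (-(3/2) : ℝ) = 2 * √2 / β ^ 3 := by
      have h5 : (√(β ^ 2 / 2)) ^ 3 = (β ^ 2 / 2) ^ (3/2 : ℝ) := by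
        rw [Real.sqrt_eq_rpow, ← Real.rpow_natCast, ← Real.rpow_mul ha.le]; norm_num
      rw [Real.rpow_neg ha.le, ← h5, Real.sqrt_div (by positivity), Real.sqrt_sq hβ.le, div_pow, inv_div]
      congr 1
      have := Real.sq_sqrt (zero_le_two (α := ℝ))
      rw [pow_succ, this]
    rw [h1, h3, h4, Real.sqrt_mul zero_le_two, ← Complex.ofReal_mul]
    congr 1
    ring
  rw [hG, ← Complex.ofReal_tsum, ← Complex.ofReal_sub, Complex.ofReal_re] at h
  have h6 : ∀ r : ℕ, (riemannZeta (-1 / 2 - (r : ℂ)) * (-((β ^ 2 / 2 : ℝ) : ℂ)) ^ r / r.factorial).re =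
      (riemannZeta (-1 / 2 - (r : ℂ))).re * (-β ^ 2 / 2) ^ r / r.factorial := by
    intro r
    have : riemannZeta (-1 / 2 - (r : ℂ)) * (-((β ^ 2 / 2 : ℝ) : ℂ)) ^ r / r.factorial =
        riemannZeta (-1 / 2 - (r : ℂ)) * (((-β ^ 2 / 2) ^ r / r.factorial : ℝ) : ℂ) := by
      push_cast; ring
    rw [this, Complex.re_mul_ofReal]; ring
  simp only [h6] at h
  rw [h.tsum_eq]
  have h7 : ∀ n : ℕ, Real.exp (-((n : ℝ) + 1) * β ^ 2 / 2) = Real.exp (-(β ^ 2 / 2 * ((n:ℝ)+1))) := by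
    intro n; congr 1; ring
  simp only [h7]
  have h8 : √(2 * π) ≠ 0 := by positivity
  field_simp
  ring
end

section
/- The limit as ε ↓ 0 of (I(ε) − (3/4)·ε^{-4}) equals −1/24, where I(ε) = ∑_{n=1}^∞ n·(1/√(2π))·∫_{ε√n}^∞ e^{-x²/2} dx. -/
open Real MeasureTheory Set Filter

lemma craig_aux (x : ℝ) (hx : 0 < x) :
    (1 / Real.sqrt (2 * π)) * ∫ u in Ioi x, Real.exp (-u ^ 2 / 2)
      = (1 / π) * ∫ t in Ioi (0:ℝ), Real.exp (-(x ^ 2 * (1 + t ^ 2) / 2)) * (1 + t ^ 2)⁻¹ := by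
  set f : ℝ → ℝ → ℝ := fun u t => u * Real.exp (-(u ^ 2 * (1 + t ^ 2) / 2)) with hf
  have hfe : ∀ u t, f u t = u * Real.exp (-u ^ 2 / 2) * Real.exp (-(u ^ 2 / 2) * t ^ 2) := by
    intro u t
    simp only [hf]
    rw [mul_assoc, ← Real.exp_add]
    congr 2; ring
  have hin : ∀ u ∈ Ioi x, ∫ t in Ioi (0:ℝ), f u t = √(π / 2) * Real.exp (-u ^ 2 / 2) := by
    intro u hu
    have hu0 : 0 < u := hx.trans hu
    simp_rw [hfe]
    rw [integral_const_mul, integral_gaussian_Ioi]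
    have : √(π / (u ^ 2 / 2)) = 2 * √(π / 2) / u := by
      rw [show π / (u ^ 2 / 2) = (2 / u) ^ 2 * (π / 2) by field_simp, Real.sqrt_mul (by positivity),
        Real.sqrt_sq (by positivity)]
      ring
    rw [this]; field_simp
  have hgi : Integrable (fun u : ℝ => √(π / 2) * Real.exp (-u ^ 2 / 2)) (volume.restrict (Ioi x)) := by
    have := (integrable_exp_neg_mul_sq (b := 1/2) (by norm_num)).const_mul (√(π / 2))
    refine (Integrable.congr this ?_).integrableOn
    exact ae_of_all _ fun u => by
      change _ * _ = _ * _
      congr 2; ring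
  have hint : Integrable (Function.uncurry f)
      ((volume.restrict (Ioi x)).prod (volume.restrict (Ioi (0:ℝ)))) := by
    rw [integrable_prod_iff]
    · constructor
      · refine (ae_restrict_iff' measurableSet_Ioi).2 (ae_of_all _ fun u hu => ?_)
        have hu0 : 0 < u := hx.trans hu
        simp only [Function.uncurry_apply_pair]
        simp_rw [hfe]
        exact ((integrable_exp_neg_mul_sq (b := u^2/2) (by positivity)).const_mul _).integrableOn
      · refine hgi.congr ?_
        refine (ae_restrict_iff' measurableSet_Ioi).2 (ae_of_all _ fun u hu => ?_)
        have hu0 : 0 < u := hx.trans hu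
        simp only [Function.uncurry_apply_pair]
        rw [← hin u hu]
        congr 1; ext t
        rw [Real.norm_of_nonneg]
        simp only [hf]; positivity
    · apply Continuous.aestronglyMeasurable
      simp only [hf, Function.uncurry_def]
      fun_prop
  have hswap := integral_integral_swap hint
  have hL : ∫ u in Ioi x, ∫ t in Ioi (0:ℝ), f u t = √(π / 2) * ∫ u in Ioi x, Real.exp (-u ^ 2 / 2) := by
    rw [setIntegral_congr_fun measurableSet_Ioi hin, integral_const_mul]
  have hR : ∀ t : ℝ, ∫ u in Ioi x, f u t = Real.exp (-(x ^ 2 * (1 + t ^ 2) / 2)) * (1 + t ^ 2)⁻¹ := by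
    intro t
    have ht : 0 < 1 + t ^ 2 := by positivity
    have hd : ∀ u ∈ Ici x, HasDerivAt
        (fun u : ℝ => -(Real.exp (-(u ^ 2 * (1 + t ^ 2) / 2)) * (1 + t ^ 2)⁻¹)) (f u t) u := by
      intro u _
      have h := ((((((hasDerivAt_id u).pow 2).mul_const (1 + t ^ 2)).div_const 2).neg.exp).mul_const
        ((1 + t ^ 2)⁻¹)).neg
      simp only [id, Pi.pow_apply] at h
      refine h.congr_deriv ?_
      simp only [hf]
      norm_num
      field_simp
    have hlim : Tendsto (fun u : ℝ => -(Real.exp (-(u ^ 2 * (1 + t ^ 2) / 2)) * (1 + t ^ 2)⁻¹))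
        atTop (nhds 0) := by
      have h1 : Tendsto (fun u : ℝ => u ^ 2 * ((1 + t ^ 2) / 2)) atTop atTop :=
        (tendsto_pow_atTop (by norm_num)).atTop_mul_const (by positivity)
      have h2 := ((Real.tendsto_exp_neg_atTop_nhds_zero.comp h1).mul_const ((1 + t ^ 2)⁻¹)).neg
      simp only [zero_mul, neg_zero] at h2
      refine h2.congr fun u => ?_
      simp only [Function.comp]
      congr 4; ring
    rw [integral_Ioi_of_hasDerivAt_of_nonneg' hd (fun u hu => ?_) hlim]
    · ring
    · have hu0 : 0 < u := hx.trans hu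
      simp only [hf]; positivity
  simp_rw [hR] at hswap
  rw [← hswap, hL, Real.sqrt_mul (by norm_num), Real.sqrt_div (by positivity)]
  have h2 : (√2) ≠ 0 := by positivity
  have hp : (√π) ≠ 0 := by positivity
  have hpp : π = √π * √π := (Real.mul_self_sqrt pi_pos.le).symm
  have : 1 / (√2 * √π) = 1 / π * (√π / √2) := by
    have : π ≠ 0 := pi_pos.ne'
    field_simp
    rw [sq]; exact hpp
  rw [this]; ring

lemma int_cube : IntegrableOn (fun t : ℝ => ((1 + t ^ 2) ^ 3)⁻¹) (Ioi 0) ∧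
    ∫ t in Ioi (0:ℝ), ((1 + t ^ 2) ^ 3)⁻¹ = 3 * π / 16 := by
  have hd : ∀ t ∈ Ici (0:ℝ), HasDerivAt (fun t : ℝ => t / (4 * (1 + t ^ 2) ^ 2)
      + 3 * t / (8 * (1 + t ^ 2)) + 3 / 8 * Real.arctan t) (((1 + t ^ 2) ^ 3)⁻¹) t := by
    intro t _
    have ht : 1 + t ^ 2 ≠ 0 := by positivity
    have hq : HasDerivAt (fun t : ℝ => 1 + t ^ 2) (2 * t) t := by
      simpa using (hasDerivAt_pow 2 t).const_add 1
    have h1 := (hasDerivAt_id t).div ((hq.pow 2).const_mul 4) (by simpa using ht)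
    have h2 := ((hasDerivAt_id t).const_mul 3).div (hq.const_mul 8) (by simpa using ht)
    have h3 := (Real.hasDerivAt_arctan t).const_mul (3 / 8)
    refine ((h1.add h2).add h3).congr_deriv ?_
    simp
    field_simp
    ring
  have hlim : Tendsto (fun t : ℝ => t / (4 * (1 + t ^ 2) ^ 2)
      + 3 * t / (8 * (1 + t ^ 2)) + 3 / 8 * Real.arctan t) atTop (nhds (3 * π / 16)) := by
    have h3 : Tendsto (fun t : ℝ => 3 / 8 * Real.arctan t) atTop (nhds (3 / 8 * (π / 2))) :=
      (tendsto_nhds_of_tendsto_nhdsWithin tendsto_arctan_atTop).const_mul _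
    have h0 : Tendsto (fun t : ℝ => t⁻¹) atTop (nhds 0) := tendsto_inv_atTop_zero
    have h1 : Tendsto (fun t : ℝ => t / (4 * (1 + t ^ 2) ^ 2)) atTop (nhds 0) := by
      refine squeeze_zero' ?_ ?_ h0
      · filter_upwards [eventually_gt_atTop 0] with t ht
        positivity
      · filter_upwards [eventually_gt_atTop 0] with t ht
        rw [inv_eq_one_div, div_le_div_iff₀ (by positivity) ht]
        nlinarith [sq_nonneg t, sq_nonneg (t^2)]
    have h2 : Tendsto (fun t : ℝ => 3 * t / (8 * (1 + t ^ 2))) atTop (nhds 0) := by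
      refine squeeze_zero' ?_ ?_ h0
      · filter_upwards [eventually_gt_atTop 0] with t ht
        positivity
      · filter_upwards [eventually_gt_atTop 0] with t ht
        rw [inv_eq_one_div, div_le_div_iff₀ (by positivity) ht]
        nlinarith [sq_nonneg t]
    have := (h1.add h2).add h3
    convert this using 2
    ring
  have hp : ∀ t ∈ Ioi (0:ℝ), 0 ≤ ((1 + t ^ 2) ^ 3)⁻¹ := fun t _ => by positivity
  refine ⟨integrableOn_Ioi_deriv_of_nonneg' hd hp hlim, ?_⟩
  rw [integral_Ioi_of_hasDerivAt_of_nonneg' hd hp hlim]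
  simp

noncomputable def gaux (s : ℝ) : ℝ := Real.exp (-s) / (1 - Real.exp (-s)) ^ 2 - 1 / s ^ 2

lemma gaux_eq (s : ℝ) (hs : 0 < s) :
    gaux s = (1 / 4) * (1 / Real.sinh (s / 2) ^ 2 - 1 / (s / 2) ^ 2) := by
  have hE : Real.exp (-s) = (Real.exp (s / 2))⁻¹ ^ 2 := by
    rw [← Real.exp_neg, ← Real.exp_nat_mul]; congr 1; push_cast; ring
  have h1 : 1 < Real.exp (s / 2) := Real.one_lt_exp_iff.2 (by positivity)
  unfold gaux
  rw [hE, Real.sinh_eq, Real.exp_neg]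
  set E := Real.exp (s / 2)
  have hne : E ^ 2 - 1 ≠ 0 := by nlinarith
  have hE0 : E ≠ 0 := by positivity
  have : 1 - E⁻¹ ^ 2 = (E ^ 2 - 1) / E ^ 2 := by field_simp
  rw [this]
  have : E - E⁻¹ = (E ^ 2 - 1) / E := by field_simp
  rw [this]
  field_simp
  ring

lemma sinh_le_mul_cosh (y : ℝ) (hy : 0 ≤ y) : Real.sinh y ≤ y * Real.cosh y := by
  have hd : ∀ t : ℝ, HasDerivAt (fun t : ℝ => t * Real.cosh t - Real.sinh t) (t * Real.sinh t) t := by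
    intro t
    have := ((hasDerivAt_id t).mul (Real.hasDerivAt_cosh t)).sub (Real.hasDerivAt_sinh t)
    refine this.congr_deriv ?_
    simp
  have hm : MonotoneOn (fun t : ℝ => t * Real.cosh t - Real.sinh t) (Ici 0) := by
    refine monotoneOn_of_deriv_nonneg (convex_Ici 0) (by fun_prop) (by fun_prop) ?_
    intro t ht
    rw [interior_Ici] at ht
    rw [(hd t).deriv]
    exact mul_nonneg (le_of_lt ht) (Real.sinh_nonneg_iff.2 (le_of_lt ht))
  have := hm (self_mem_Ici) hy hy
  simp at this
  linarith

lemma gaux_bound (s : ℝ) (hs : 0 < s) : |gaux s| ≤ 1 := by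
  rw [gaux_eq s hs]
  set y := s / 2 with hy
  have hy0 : 0 < y := by positivity
  have h1 : y ≤ Real.sinh y := Real.self_le_sinh_iff.2 hy0.le
  have h2 := sinh_le_mul_cosh y hy0.le
  have h3 := Real.cosh_sq y
  have hS : 0 < Real.sinh y := hy0.trans_le h1
  have hu : 1 / Real.sinh y ^ 2 ≤ 1 / y ^ 2 := by gcongr
  have hl : 1 / y ^ 2 ≤ 1 / Real.sinh y ^ 2 + 1 := by
    have : Real.sinh y ^ 2 ≤ y ^ 2 * (Real.sinh y ^ 2 + 1) := by
      rw [← h3, ← mul_pow]; gcongr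
    rw [div_add_one (by positivity), div_le_div_iff₀ (by positivity) (by positivity)]
    nlinarith
  rw [abs_le]; constructor <;> linarith

lemma hlim_aux : Tendsto (fun y : ℝ => (Real.sinh y - y) / y ^ 3) (nhdsWithin 0 (Ioi 0))
    (nhds (1 / 6)) := by
  rw [tendsto_iff_norm_sub_tendsto_zero]
  have h0 : Tendsto (fun y : ℝ => y) (nhdsWithin 0 (Ioi 0)) (nhds 0) :=
    tendsto_nhdsWithin_of_tendsto_nhds tendsto_id
  refine squeeze_zero' (Eventually.of_forall fun _ => norm_nonneg _) ?_ h0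
  filter_upwards [Ioc_mem_nhdsGT (show (0:ℝ) < 1 by norm_num)] with y hy
  obtain ⟨hy0, hy1⟩ := hy
  have e1 := Real.exp_bound (x := y) (by rw [abs_of_pos hy0]; exact hy1) (n := 4) (by norm_num)
  have e2 := Real.exp_bound (x := -y) (by rw [abs_neg, abs_of_pos hy0]; exact hy1) (n := 4) (by norm_num)
  simp only [Finset.sum_range_succ, Finset.sum_range_zero, abs_neg, abs_of_pos hy0, Nat.factorial] at e1 e2
  norm_num at e1 e2
  have : (Real.sinh y - y) / y ^ 3 - 1 / 6 = (Real.sinh y - y - y ^ 3 / 6) / y ^ 3 := by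
    field_simp
  rw [this, Real.norm_eq_abs, abs_div, abs_of_pos (show 0 < y ^ 3 by positivity),
    div_le_iff₀ (by positivity), Real.sinh_eq]
  rw [abs_le] at *
  have : 0 < y ^ 4 := by positivity
  constructor <;> nlinarith

lemma gaux_tendsto : Tendsto gaux (nhdsWithin 0 (Ioi 0)) (nhds (-1 / 12)) := by
  have h0 : Tendsto (fun y : ℝ => y) (nhdsWithin 0 (Ioi 0)) (nhds 0) :=
    tendsto_nhdsWithin_of_tendsto_nhds tendsto_id
  have hk : Tendsto (fun y : ℝ => 1 + y ^ 2 * ((Real.sinh y - y) / y ^ 3)) (nhdsWithin 0 (Ioi 0))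
      (nhds (1 + 0 ^ 2 * (1 / 6))) := ((h0.pow 2).mul hlim_aux).const_add 1
  have hm := ((hlim_aux.mul (hk.add_const 1)).div (hk.pow 2) (by norm_num)).const_mul (-(1 / 4))
  have hh : Tendsto (fun s : ℝ => s / 2) (nhdsWithin 0 (Ioi 0)) (nhdsWithin 0 (Ioi 0)) := by
    apply tendsto_nhdsWithin_of_tendsto_nhds_of_eventually_within
    · simpa using h0.div_const 2
    · filter_upwards [self_mem_nhdsWithin] with s hs
      exact half_pos (show 0 < s from hs)
  have := hm.comp hh
  norm_num at this ⊢
  refine this.congr' ?_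
  filter_upwards [self_mem_nhdsWithin] with s hs
  have hs : 0 < s := hs
  rw [gaux_eq s hs]
  simp only [Function.comp]
  set y := s / 2 with hy
  have hy0 : 0 < y := by positivity
  have hS : 0 < Real.sinh y := Real.sinh_pos_iff.2 hy0
  have : 1 + y ^ 2 * ((Real.sinh y - y) / y ^ 3) = Real.sinh y / y := by field_simp; ring
  rw [this]
  field_simp
  ring

lemma sum_eq (ε : ℝ) (hε : 0 < ε) :
    (∑' n : ℕ, ((n : ℝ) + 1) * ((1 / Real.sqrt (2 * π)) *
          ∫ x in Ioi (ε * Real.sqrt ((n : ℝ) + 1)), Real.exp (-x ^ 2 / 2)))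
        - 3 / 4 * ε ^ (-4 : ℤ)
    = (1 / π) * ∫ t in Ioi (0:ℝ), gaux (ε ^ 2 * (1 + t ^ 2) / 2) * (1 + t ^ 2)⁻¹ := by
  set F : ℕ → ℝ → ℝ := fun n t => ((n : ℝ) + 1) *
    Real.exp (-(ε ^ 2 * (1 + t ^ 2) / 2)) ^ (n + 1) * (1 + t ^ 2)⁻¹ with hF
  have hterm : ∀ n : ℕ, ((n : ℝ) + 1) * ((1 / Real.sqrt (2 * π)) *
          ∫ x in Ioi (ε * Real.sqrt ((n : ℝ) + 1)), Real.exp (-x ^ 2 / 2))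
      = (1 / π) * ∫ t in Ioi (0:ℝ), F n t := by
    intro n
    rw [craig_aux _ (by positivity), mul_left_comm, ← integral_const_mul]
    congr 2; ext t
    simp only [hF]
    rw [← Real.exp_nat_mul, mul_pow, Real.sq_sqrt (by positivity), ← mul_assoc]
    congr 3; push_cast; ring
  have hgeo : ∀ s : ℝ, 0 < s → HasSum (fun n : ℕ => ((n:ℝ) + 1) * Real.exp (-s) ^ (n + 1))
      (Real.exp (-s) / (1 - Real.exp (-s)) ^ 2) := by
    intro s hs
    have := hasSum_coe_mul_geometric_of_norm_lt_one (r := Real.exp (-s))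
      (by rw [Real.norm_of_nonneg (Real.exp_pos _).le]; rw [Real.exp_lt_one_iff]; linarith)
    have h2 := (hasSum_nat_add_iff' 1).2 this
    simpa using h2
  have hb : ∀ n t, F n t ≤ (((n : ℝ) + 1) * Real.exp (-(ε ^ 2 / 2)) ^ (n + 1)) * (1 + t ^ 2)⁻¹ := by
    intro n t
    simp only [hF]
    gcongr
    nlinarith [mul_nonneg (sq_nonneg ε) (sq_nonneg t)]
  have hF0 : ∀ n t, 0 ≤ F n t := by intro n t; simp only [hF]; positivity
  have hmeas : ∀ n, Measurable (F n) := by intro n; simp only [hF]; fun_prop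
  have hI : Integrable (fun t : ℝ => (1 + t ^ 2)⁻¹) (volume.restrict (Ioi 0)) :=
    integrable_inv_one_add_sq.integrableOn
  have hFi : ∀ n, Integrable (F n) (volume.restrict (Ioi 0)) := by
    intro n
    refine (hI.const_mul (((n : ℝ) + 1) * Real.exp (-(ε ^ 2 / 2)) ^ (n + 1))).mono'
      (hmeas n).aestronglyMeasurable (ae_of_all _ fun t => ?_)
    rw [Real.norm_of_nonneg (hF0 n t)]; exact hb n t
  have hsum : Summable fun n => ∫ t in Ioi (0:ℝ), ‖F n t‖ := by
    refine Summable.of_nonneg_of_le (fun n => integral_nonneg fun t => norm_nonneg _) ?_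
      ((hgeo (ε ^ 2 / 2) (by positivity)).summable.mul_right (∫ t in Ioi (0:ℝ), (1 + t ^ 2)⁻¹))
    intro n
    rw [← integral_const_mul]
    refine integral_mono (hFi n).norm (hI.const_mul _) fun t => ?_
    simp only
    rw [Real.norm_of_nonneg (hF0 n t)]; exact hb n t
  have hS := hasSum_integral_of_summable_integral_norm hFi hsum
  simp_rw [hterm]
  rw [tsum_mul_left, hS.tsum_eq]
  have hpt : ∀ t : ℝ, ∑' n, F n t = gaux (ε ^ 2 * (1 + t ^ 2) / 2) * (1 + t ^ 2)⁻¹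
      + 4 / ε ^ 4 * ((1 + t ^ 2) ^ 3)⁻¹ := by
    intro t
    have := (hgeo (ε ^ 2 * (1 + t ^ 2) / 2) (by positivity)).mul_right ((1 + t ^ 2)⁻¹)
    rw [this.tsum_eq, gaux]
    have h4 : 1 / (ε ^ 2 * (1 + t ^ 2) / 2) ^ 2 * (1 + t ^ 2)⁻¹ = 4 / ε ^ 4 * ((1 + t ^ 2) ^ 3)⁻¹ := by
      have : 1 + t ^ 2 ≠ 0 := by positivity
      field_simp
      norm_num
    rw [sub_mul, h4]
    ring
  simp_rw [hpt]
  have hG : Integrable (fun t : ℝ => gaux (ε ^ 2 * (1 + t ^ 2) / 2) * (1 + t ^ 2)⁻¹)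
      (volume.restrict (Ioi 0)) := by
    refine hI.mono' (Measurable.aestronglyMeasurable (by unfold gaux; fun_prop)) (ae_of_all _ fun t => ?_)
    rw [norm_mul, Real.norm_eq_abs, Real.norm_of_nonneg (show 0 ≤ (1 + t ^ 2)⁻¹ by positivity)]
    exact mul_le_of_le_one_left (by positivity) (gaux_bound _ (by positivity))
  rw [integral_add hG (int_cube.1.const_mul _), integral_const_mul, int_cube.2]
  have : π ≠ 0 := pi_pos.ne'
  rw [zpow_neg, mul_add]
  norm_cast
  field_simp
  ring

/-- `lim_{ε ↓ 0} (I(ε) − (3/4)ε^{-4}) = −1/24`, where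
`I(ε) = ∑_{n≥1} n·(1/√(2π))·∫_{ε√n}^∞ e^{-x²/2} dx`. -/
theorem limit_I_minus_three_quarter_inv_four :
    Tendsto (fun ε : ℝ =>
        (∑' n : ℕ, ((n : ℝ) + 1) * ((1 / Real.sqrt (2 * π)) *
          ∫ x in Ioi (ε * Real.sqrt ((n : ℝ) + 1)), Real.exp (-x ^ 2 / 2)))
        - 3 / 4 * ε ^ (-4 : ℤ))
      (nhdsWithin 0 (Ioi 0)) (nhds (-1 / 24)) := by
  have hmain : Tendsto (fun ε : ℝ => ∫ t in Ioi (0:ℝ), gaux (ε ^ 2 * (1 + t ^ 2) / 2) * (1 + t ^ 2)⁻¹)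
      (nhdsWithin 0 (Ioi 0)) (nhds (∫ t in Ioi (0:ℝ), (-1 / 12) * (1 + t ^ 2)⁻¹)) := by
    refine tendsto_integral_filter_of_dominated_convergence (fun t => (1 + t ^ 2)⁻¹) ?_ ?_
      integrable_inv_one_add_sq.integrableOn ?_
    · exact Eventually.of_forall fun ε =>
        Measurable.aestronglyMeasurable (by unfold gaux; fun_prop)
    · filter_upwards [self_mem_nhdsWithin] with ε hε
      have hε : 0 < ε := hε
      refine ae_of_all _ fun t => ?_
      rw [norm_mul, Real.norm_eq_abs, Real.norm_of_nonneg (show 0 ≤ (1 + t ^ 2)⁻¹ by positivity)]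
      exact mul_le_of_le_one_left (by positivity) (gaux_bound _ (by positivity))
    · refine ae_of_all _ fun t => ?_
      refine Tendsto.mul_const _ (gaux_tendsto.comp ?_)
      apply tendsto_nhdsWithin_of_tendsto_nhds_of_eventually_within
      · apply tendsto_nhdsWithin_of_tendsto_nhds
        have : Continuous (fun ε : ℝ => ε ^ 2 * (1 + t ^ 2) / 2) := by fun_prop
        simpa using this.tendsto 0
      · filter_upwards [self_mem_nhdsWithin] with ε hε
        have hε : 0 < ε := hε
        rw [mem_Ioi]
        positivity
  rw [integral_const_mul, integral_Ioi_inv_one_add_sq] at hmain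
  have h := hmain.const_mul (1 / π)
  have hv : 1 / π * (-1 / 12 * (π / 2 - Real.arctan 0)) = -1 / 24 := by
    have : π ≠ 0 := pi_pos.ne'
    rw [Real.arctan_zero]
    field_simp
    ring
  rw [hv] at h
  refine h.congr' ?_
  filter_upwards [self_mem_nhdsWithin] with ε hε
  exact (sum_eq ε hε).symm
end
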